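/- arXiv:1210.5736 — 2 statements merged into one kernel-verified Lean document; each statement's English description precedes it below -/
import Mathlib

section
/- There exists a positive real constant c such that for every integer n ≥ 1, the number of isomorphism classes of connected 3-valent vertex-transitive graphs Γ with at most n vertices and with |Aut(Γ)| > n² is at most c·n². -/
open SimpleGraph

/-- Finite graphs, presented as graphs on `Fin m` for some `m`. -/
def GSig := Σ m : ℕ, SimpleGraph (Fin m)

/-- Graphs satisfying `P`, up to isomorphism. -/
def graphSetoid (P : GSig → Prop) : Setoid {x : GSig // P x} where
  r a b := Nonempty (a.1.2 ≃g b.1.2)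
  iseqv := ⟨fun _ => ⟨RelIso.refl _⟩, fun ⟨e⟩ => ⟨e.symm⟩, fun ⟨e⟩ ⟨f⟩ => ⟨e.trans f⟩⟩

/-- The number of isomorphism classes of finite graphs satisfying `P`. -/
noncomputable def numIsoClasses (P : GSig → Prop) : ℕ :=
  Nat.card (Quotient (graphSetoid P))

/-- `Γ` is regular of valency `d`. -/
def DValent {V : Type*} (Γ : SimpleGraph V) (d : ℕ) : Prop :=
  ∀ v, (Γ.neighborSet v).ncard = d

/-- `Γ` is vertex-transitive: its full automorphism group acts transitively on vertices. -/
def IsVertexTransitive {V : Type*} (Γ : SimpleGraph V) : Prop :=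
  ∀ u v : V, ∃ φ : Γ ≃g Γ, φ u = v

/-- The number of isomorphism classes of connected 3-valent vertex-transitive graphs with at
most `n` vertices whose full automorphism group has more than `n²` elements. -/
noncomputable def bigAutCount (n : ℕ) : ℕ :=
  numIsoClasses (fun x => x.1 ≤ n ∧ x.2.Connected ∧ DValent x.2 3 ∧
    IsVertexTransitive x.2 ∧ n ^ 2 < Nat.card (x.2 ≃g x.2))

/-- A sequence of involutions permuted by conjugation with `τ`. -/
structure ShiftSystem {G : Type*} [Group G] (τ : G) (a : ℤ → G) : Prop where
  sq : ∀ i, a i * a i = 1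
  shift : ∀ i, τ * a i * τ⁻¹ = a (i + 1)

/-- The subgroup generated by `a i, …, a j`. -/
def window {G : Type*} [Group G] (a : ℤ → G) (i j : ℤ) : Subgroup G :=
  Subgroup.closure (a '' Set.Icc i j)

/-- Windows of length at most `s` are built from shorter ones by index two extensions,
on either side. -/
structure RegWindows {G : Type*} [Group G] (a : ℤ → G) (s : ℤ) : Prop where
  right_notMem : ∀ i j, i ≤ j → j - i < s → a j ∉ window a i (j - 1)
  right_conj : ∀ i j, i ≤ j → j - i < s → ∀ w ∈ window a i (j - 1),
    a j * w * a j ∈ window a i (j - 1)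
  left_notMem : ∀ i j, i ≤ j → j - i < s → a i ∉ window a (i + 1) j
  left_conj : ∀ i j, i ≤ j → j - i < s → ∀ w ∈ window a (i + 1) j,
    a i * w * a i ∈ window a (i + 1) j

section Windows

variable {G : Type*} [Group G] {τ : G} {a : ℤ → G}

theorem mem_window {i j k : ℤ} (h₁ : i ≤ k) (h₂ : k ≤ j) : a k ∈ window a i j :=
  Subgroup.subset_closure ⟨k, ⟨h₁, h₂⟩, rfl⟩

theorem window_le {H : Subgroup G} {i j : ℤ} (h : ∀ k, i ≤ k → k ≤ j → a k ∈ H) :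
    window a i j ≤ H := by
  rw [window, Subgroup.closure_le]
  rintro _ ⟨k, ⟨h₁, h₂⟩, rfl⟩
  exact h k h₁ h₂

theorem window_mono {i j i' j' : ℤ} (h₁ : i' ≤ i) (h₂ : j ≤ j') :
    window a i j ≤ window a i' j' :=
  window_le fun _ h h' => mem_window (h₁.trans h) (h'.trans h₂)

theorem window_eq_bot {i j : ℤ} (h : j < i) : window a i j = ⊥ :=
  le_bot_iff.1 (window_le fun _ h₁ h₂ => absurd (h₁.trans h₂) (not_le.2 h))

theorem commute_window {g w : G} {i j : ℤ} (h : ∀ k, i ≤ k → k ≤ j → Commute g (a k))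
    (hw : w ∈ window a i j) : Commute g w := by
  have : window a i j ≤ Subgroup.centralizer {g} := window_le fun k h₁ h₂ => by
    rw [Subgroup.mem_centralizer_singleton_iff]
    exact (h k h₁ h₂).symm.eq
  have := this hw
  rw [Subgroup.mem_centralizer_singleton_iff] at this
  exact (Commute.symm this)

theorem conj_mem_of_window {H : Subgroup G} {g w : G} {i j : ℤ}
    (h : ∀ k, i ≤ k → k ≤ j → g * a k * g⁻¹ ∈ H) (hw : w ∈ window a i j) :
    g * w * g⁻¹ ∈ H := by
  have : window a i j ≤ H.comap (MulAut.conj g).toMonoidHom := window_le fun k h₁ h₂ => by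
    simpa using h k h₁ h₂
  simpa using this hw

theorem window_neg (i j : ℤ) : window (fun k => a (-k)) i j = window a (-j) (-i) := by
  apply le_antisymm
  · exact window_le fun k h₁ h₂ => mem_window (by omega) (by omega)
  · refine window_le fun k h₁ h₂ => ?_
    have := mem_window (a := fun k => a (-k)) (i := i) (j := j) (k := -k) (by omega) (by omega)
    simpa using this

theorem RegWindows.neg {s : ℤ} (h : RegWindows a s) : RegWindows (fun k => a (-k)) s where
  right_notMem i j h₁ h₂ := by
    rw [window_neg, neg_sub']
    exact h.left_notMem (-j) (-i) (by omega) (by omega)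
  right_conj i j h₁ h₂ := by
    rw [window_neg, neg_sub']
    exact h.left_conj (-j) (-i) (by omega) (by omega)
  left_notMem i j h₁ h₂ := by
    rw [window_neg, neg_add']
    exact h.right_notMem (-j) (-i) (by omega) (by omega)
  left_conj i j h₁ h₂ := by
    rw [window_neg, neg_add']
    exact h.right_conj (-j) (-i) (by omega) (by omega)

theorem ShiftSystem.neg (h : ShiftSystem τ a) : ShiftSystem τ⁻¹ (fun k => a (-k)) where
  sq i := h.sq _
  shift i := by
    rw [neg_add', ← sub_add_cancel (-i) 1, ← h.shift, sub_add_cancel]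
    group

namespace ShiftSystem

variable (h : ShiftSystem τ a)
include h

theorem inv (i : ℤ) : (a i)⁻¹ = a i := inv_eq_of_mul_eq_one_left (h.sq i)

theorem conj_zpow (n i : ℤ) : τ ^ n * a i * (τ ^ n)⁻¹ = a (i + n) := by
  induction n using Int.induction_on with
  | zero => simp
  | succ n ih =>
    rw [← add_assoc, ← h.shift, ← ih, zpow_add_one, ← (Commute.self_zpow τ n).eq]
    group
  | pred n ih =>
    have := h.shift (i + (-n - 1))
    rw [show i + (-n - 1) + 1 = i + -(n : ℤ) by ring, ← ih] at this
    have h₂ : a (i + (-n - 1)) = τ⁻¹ * (τ ^ (-n : ℤ) * a i * (τ ^ (-n : ℤ))⁻¹) * τ := by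
      rw [← this]; group
    rw [h₂, sub_eq_neg_add, zpow_add]
    group

theorem conj_window_mem {i j : ℤ} (n : ℤ) {w : G} (hw : w ∈ window a i j) :
    τ ^ n * w * (τ ^ n)⁻¹ ∈ window a (i + n) (j + n) :=
  conj_mem_of_window (fun k h₁ h₂ => by
    rw [h.conj_zpow]; exact mem_window (by omega) (by omega)) hw

theorem conj_window_mem_iff {i j : ℤ} (n : ℤ) {w : G} :
    τ ^ n * w * (τ ^ n)⁻¹ ∈ window a (i + n) (j + n) ↔ w ∈ window a i j := by
  refine ⟨fun hw => ?_, h.conj_window_mem n⟩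
  have := h.conj_window_mem (-n) hw
  rw [add_neg_cancel_right, add_neg_cancel_right] at this
  convert this using 1
  group

theorem map_window (n i j : ℤ) :
    (window a i j).map (MulAut.conj (τ ^ n)).toMonoidHom = window a (i + n) (j + n) := by
  ext w
  rw [← Subgroup.mem_carrier]
  constructor
  · rintro ⟨v, hv, rfl⟩
    exact h.conj_window_mem n hv
  · intro hw
    refine ⟨(τ ^ n)⁻¹ * w * τ ^ n, ?_, ?_⟩
    · refine (h.conj_window_mem_iff n).1 ?_
      convert hw using 1
      group
    · simp only [MulEquiv.toMonoidHom_eq_coe, MonoidHom.coe_coe, MulAut.conj_apply]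
      group

theorem card_window_shift (n i j : ℤ) :
    Nat.card (window a (i + n) (j + n)) = Nat.card (window a i j) := by
  rw [← h.map_window n i j]
  exact Nat.card_congr ((window a i j).equivMapOfInjective _
    (MulAut.conj (τ ^ n)).injective).symm.toEquiv

/-- If a window contains the next generator, it equals its translate. -/
theorem window_eq_of_right_mem [Finite G] {i j : ℤ} (ha : a (j + 1) ∈ window a i j) :
    window a (i + 1) (j + 1) = window a i j := by
  apply Subgroup.eq_of_le_of_card_ge
  · refine window_le fun k h₁ h₂ => ?_
    rcases eq_or_lt_of_le h₂ with rfl | h₂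
    · exact ha
    · exact mem_window (by omega) (by omega)
  · exact (h.card_window_shift 1 i j).ge

end ShiftSystem

/-- Splitting off an involution which normalizes the subgroup generated by the others. -/
theorem mem_or_mul_mem_of_closure {N : Subgroup G} {c : G} (hc : c * c = 1)
    (hN : ∀ w ∈ N, c * w * c ∈ N) {S : Set G} (hS : ∀ x ∈ S, x ∈ N ∨ x = c) {w : G}
    (hw : w ∈ Subgroup.closure S) : w ∈ N ∨ w * c ∈ N := by
  have hci : c⁻¹ = c := inv_eq_of_mul_eq_one_left hc
  induction hw using Subgroup.closure_induction with
  | mem x hx =>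
    rcases hS x hx with h | rfl
    · exact .inl h
    · right; rw [hc]; exact N.one_mem
  | one => exact .inl N.one_mem
  | mul x y _ _ hx hy =>
    rcases hx with hx | hx <;> rcases hy with hy | hy
    · exact .inl (N.mul_mem hx hy)
    · right; rw [mul_assoc]; exact N.mul_mem hx hy
    · right
      have : x * y * c = (x * c) * (c * y * c) := by
        simp only [mul_assoc]; rw [← mul_assoc c c, hc, one_mul]
      rw [this]; exact N.mul_mem hx (hN _ hy)
    · left
      have : x * y = (x * c) * (c * (y * c) * c) := by
        simp only [mul_assoc]; rw [hc, ← mul_assoc c c, hc, one_mul, mul_one]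
      rw [this]; exact N.mul_mem hx (hN _ hy)
  | inv x _ hx =>
    rcases hx with hx | hx
    · exact .inl (N.inv_mem hx)
    · right
      have : x⁻¹ * c = c * (x * c)⁻¹ * c := by
        rw [mul_inv_rev, hci, ← mul_assoc c c, hc, one_mul]
      rw [this]; exact hN _ (N.inv_mem hx)

theorem card_closure_insert [Finite G] {N M : Subgroup G} {c : G} (hcN : c ∉ N) (hcM : c ∈ M)
    (hNM : N ≤ M) (h : ∀ w ∈ M, w ∈ N ∨ w * c ∈ N) : Nat.card M = 2 * Nat.card N := by
  have h2 : N.relIndex M = 2 := by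
    rw [Subgroup.relIndex_eq_two_iff]
    refine ⟨c, hcM, fun b hb => ?_⟩
    rcases h b hb with h' | h'
    · exact .inr ⟨h', fun h'' => hcN ((N.mul_mem_cancel_left h').1 h'')⟩
    · exact .inl ⟨h', fun h'' => hcN ((N.mul_mem_cancel_left h'').1 h')⟩
  have := Subgroup.relIndex_mul_relIndex ⊥ N M bot_le hNM
  rw [Subgroup.relIndex_bot_left, Subgroup.relIndex_bot_left, h2] at this
  rw [← this, mul_comm]

namespace RegWindows

variable {s : ℤ} (hs : ShiftSystem τ a) (hr : RegWindows a s)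
include hs hr

theorem right_split {i j : ℤ} (hij : i ≤ j) (hj : j - i < s) {w : G} (hw : w ∈ window a i j) :
    w ∈ window a i (j - 1) ∨ w * a j ∈ window a i (j - 1) := by
  refine mem_or_mul_mem_of_closure (hs.sq j) (hr.right_conj i j hij hj) ?_ hw
  rintro _ ⟨k, ⟨h₁, h₂⟩, rfl⟩
  rcases eq_or_lt_of_le h₂ with rfl | h₂
  · exact .inr rfl
  · exact .inl (mem_window h₁ (by omega))

theorem left_split' {i j : ℤ} (hij : i ≤ j) (hj : j - i < s) {w : G} (hw : w ∈ window a i j) :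
    w ∈ window a (i + 1) j ∨ w * a i ∈ window a (i + 1) j := by
  refine mem_or_mul_mem_of_closure (hs.sq i) (hr.left_conj i j hij hj) ?_ hw
  rintro _ ⟨k, ⟨h₁, h₂⟩, rfl⟩
  rcases eq_or_lt_of_le h₁ with rfl | h₁
  · exact .inr rfl
  · exact .inl (mem_window (by omega) h₂)

theorem left_split {i j : ℤ} (hij : i ≤ j) (hj : j - i < s) {w : G} (hw : w ∈ window a i j) :
    w ∈ window a (i + 1) j ∨ a i * w ∈ window a (i + 1) j := by
  rcases hr.left_split' hs hij hj hw with h | h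
  · exact .inl h
  · right
    have := hr.left_conj i j hij hj _ h
    rwa [mul_assoc, mul_assoc, hs.sq, mul_one] at this

theorem card_window [Finite G] (i : ℤ) (k : ℕ) (hk : (k : ℤ) ≤ s) :
    Nat.card (window a i (i + k - 1)) = 2 ^ k := by
  induction k with
  | zero => rw [window_eq_bot (by simp)]; simp
  | succ k ih =>
    push_cast at hk ⊢
    rw [pow_succ', ← ih (by omega)]
    have e : i + (k + 1 : ℤ) - 1 = i + k := by ring
    rw [e]
    exact card_closure_insert (hr.right_notMem i (i + k) (by omega) (by omega))
      (mem_window (by omega) (by omega)) (window_mono le_rfl (by omega))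
      (fun w hw => hr.right_split hs (by omega) (by omega) hw)

theorem exists_mul {i j k : ℤ} (hij : i ≤ j + 1) (hjk : j ≤ k) (hk : k - i < s) {w : G}
    (hw : w ∈ window a i k) :
    ∃ u ∈ window a i j, ∃ v ∈ window a (j + 1) k, w = u * v := by
  induction k, hjk using Int.leInduction generalizing w with
  | base => exact ⟨w, hw, 1, Subgroup.one_mem _, by simp⟩
  | succ k hjk ih =>
    rcases hr.right_split hs (by omega) (by omega) hw with h | h
    · rw [add_sub_cancel_right] at h
      obtain ⟨u, hu, v, hv, rfl⟩ := ih (by omega) h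
      exact ⟨u, hu, v, window_mono le_rfl (by omega) hv, rfl⟩
    · rw [add_sub_cancel_right] at h
      obtain ⟨u, hu, v, hv, e⟩ := ih (by omega) h
      refine ⟨u, hu, v * a (k + 1), Subgroup.mul_mem _ (window_mono le_rfl (by omega) hv)
        (mem_window (by omega) le_rfl), ?_⟩
      rw [← mul_assoc, ← e, mul_assoc, hs.sq, mul_one]

theorem eq_one_of_mem {i j k : ℤ} (hij : i ≤ j + 1) (hjk : j ≤ k) (hk : k - i < s) {w : G}
    (hw : w ∈ window a i j) (hw' : w ∈ window a (j + 1) k) : w = 1 := by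
  induction k, hjk using Int.leInduction with
  | base => rwa [window_eq_bot (by omega), Subgroup.mem_bot] at hw'
  | succ k hjk ih =>
    rcases hr.right_split hs (by omega) (by omega) hw' with h | h
    · rw [add_sub_cancel_right] at h
      exact ih (by omega) h
    · rw [add_sub_cancel_right] at h
      refine absurd ?_ (hr.right_notMem i (k + 1) (by omega) (by omega))
      rw [add_sub_cancel_right]
      have : a (k + 1) = w⁻¹ * (w * a (k + 1)) := by group
      rw [this]
      exact Subgroup.mul_mem _ (Subgroup.inv_mem _ (window_mono le_rfl (by omega) hw))
        (window_mono (by omega) le_rfl h)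

end RegWindows

end Windows

/-- A shift system with regular windows of length `s` in which `l` is the least distance of
two noncommuting generators. -/
structure ShiftContext {G : Type*} [Group G] (τ : G) (a : ℤ → G) (s l : ℤ) : Prop where
  sys : ShiftSystem τ a
  reg : RegWindows a s
  pos : 0 < l
  lt : l < s
  comm : ∀ i j, i - j < l → j - i < l → Commute (a i) (a j)
  not_comm : ∀ i, ¬ Commute (a i) (a (i + l))

/-- The commutator of `a i` and `a j`, when these are involutions. -/
def genComm {G : Type*} [Group G] (a : ℤ → G) (i j : ℤ) : G := a i * a j * a i * a j

section Context

variable {G : Type*} [Group G] {τ : G} {a : ℤ → G} {s l : ℤ}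

namespace ShiftSystem

variable (h : ShiftSystem τ a)
include h

theorem mul_self_mul (i : ℤ) (g : G) : a i * (a i * g) = g := by rw [← mul_assoc, h.sq, one_mul]

theorem genComm_inv (i j : ℤ) : (genComm a i j)⁻¹ = genComm a j i := by
  simp only [genComm, mul_inv_rev, h.inv, mul_assoc]

theorem genComm_eq_one_iff (i j : ℤ) : genComm a i j = 1 ↔ Commute (a i) (a j) := by
  rw [genComm, mul_assoc (a i * a j), mul_eq_one_iff_eq_inv, mul_inv_rev, h.inv, h.inv]
  rfl

theorem genComm_conj (n i j : ℤ) :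
    τ ^ n * genComm a i j * (τ ^ n)⁻¹ = genComm a (i + n) (j + n) := by
  simp only [genComm, ← h.conj_zpow n]
  group

theorem genComm_mem (hr : RegWindows a s) {i j : ℤ} (hij : i < j) (hj : j - i < s) :
    genComm a i j ∈ window a (i + 1) (j - 1) := by
  have h1 := hr.left_conj i j hij.le hj (a j) (mem_window (by omega) le_rfl)
  rcases hr.right_split h (by omega) (by omega) h1 with h2 | h2
  · refine absurd ?_ (hr.right_notMem i j hij.le hj)
    have : a j = a i * (a i * a j * a i) * a i := by
      simp only [mul_assoc, h.mul_self_mul, h.sq, mul_one]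
    rw [this]
    exact Subgroup.mul_mem _ (Subgroup.mul_mem _ (mem_window le_rfl (by omega))
      (window_mono (by omega) le_rfl h2)) (mem_window le_rfl (by omega))
  · exact h2

end ShiftSystem

theorem ShiftSystem.commute_conj_symm (h : ShiftSystem τ a) {i : ℤ} {x y : G}
    (hc : Commute x (a i * y * a i)) : Commute (a i * x * a i) y := by
  have e : y = a i * (a i * y * a i) * a i := by
    simp only [mul_assoc, h.mul_self_mul, h.sq, mul_one]
  have h2 : ∀ x y, (a i * x * a i) * (a i * y * a i) = a i * (x * y) * a i := by
    intro x y; simp only [mul_assoc, h.mul_self_mul]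
  rw [e, commute_iff_eq, h2, h2, hc.eq]

/-- All commutators of generators at distance at most `k` commute with the generators lying
in a common interval of length `k` with them. -/
def CentralComm (a : ℤ → G) (k : ℤ) : Prop :=
  ∀ i m j, i ≤ m → m - i ≤ k → m - k ≤ j → j ≤ i + k → Commute (genComm a i m) (a j)

theorem CentralComm.neg (hs : ShiftSystem τ a) {k : ℤ} (h : CentralComm a k) :
    CentralComm (fun i => a (-i)) k := by
  intro i m j h1 h2 h3 h4
  have := h (-m) (-i) (-j) (by omega) (by omega) (by omega) (by omega)
  rw [← hs.genComm_inv, Commute.inv_left_iff] at this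
  exact this

namespace ShiftContext

variable (h : ShiftContext τ a s l)
include h

theorem neg : ShiftContext τ⁻¹ (fun i => a (-i)) s l where
  sys := h.sys.neg
  reg := h.reg.neg
  pos := h.pos
  lt := h.lt
  comm i j h₁ h₂ := h.comm _ _ (by omega) (by omega)
  not_comm i hc := h.not_comm (-(i + l)) (by
    have e : -(i + l) + l = -i := by ring
    rw [e]; exact hc.symm)

theorem mem_min {i j : ℤ} (hj : j - i < s) (hl : j < i + 2 * l) {w : G}
    (hw : w ∈ window a i j) (hc : Commute w (a (i + l))) : w ∈ window a (i + 1) j := by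
  rcases lt_or_ge j i with hij | hij
  · rw [window_eq_bot hij, Subgroup.mem_bot] at hw
    rw [hw]; exact Subgroup.one_mem _
  rcases h.reg.left_split' h.sys hij hj hw with h1 | h1
  · exact h1
  · have h2 : Commute (a (i + l)) (w * a i) :=
      commute_window (fun k hk hk' => h.comm _ _ (by omega) (by omega)) h1
    have h3 : Commute (a (i + l)) (w⁻¹ * (w * a i)) := (hc.symm.inv_right).mul_right h2
    rw [inv_mul_cancel_left] at h3
    exact absurd h3.symm (h.not_comm i)

theorem mem_max {i j : ℤ} (hj : j - i < s) (hl : j - 2 * l < i) {w : G}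
    (hw : w ∈ window a i j) (hc : Commute w (a (j - l))) : w ∈ window a i (j - 1) := by
  have := h.neg.mem_min (i := -j) (j := -i) (w := w) (by omega) (by omega)
    (by rw [window_neg]; simpa using hw) (by
      have e : -(-j + l) = j - l := by ring
      rw [e]; exact hc)
  rw [window_neg] at this
  have e : -(-j + 1) = j - 1 := by ring
  rwa [neg_neg, e] at this

theorem mem_min_iter {i i' j : ℤ} (hi : i ≤ i') (hj : j - i < s) (hl : j < i + 2 * l) {w : G}
    (hw : w ∈ window a i j) (hc : ∀ k, i ≤ k → k < i' → Commute w (a (k + l))) :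
    w ∈ window a i' j := by
  induction i', hi using Int.leInduction with
  | base => exact hw
  | succ k hk ih =>
    exact h.mem_min (by omega) (by omega) (ih fun t h1 h2 => hc t h1 (by omega))
      (hc k hk (by omega))

theorem mem_max_iter {i j j' : ℤ} (hjj : j' ≤ j) (hj : j - i < s) (hl : j - 2 * l < i) {w : G}
    (hw : w ∈ window a i j) (hc : ∀ k, j' < k → k ≤ j → Commute w (a (k - l))) :
    w ∈ window a i j' := by
  have := h.neg.mem_min_iter (i := -j) (i' := -j') (j := -i) (w := w) (by omega) (by omega)
    (by omega) (by rw [window_neg]; simpa using hw) (fun k h1 h2 => by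
      have e : -(k + l) = (-k) - l := by ring
      simp only [e]; exact hc _ (by omega) (by omega))
  rw [window_neg] at this
  simpa using this

theorem z_ne_one (i : ℤ) : genComm a i (i + l) ≠ 1 := fun e =>
  h.not_comm i ((h.sys.genComm_eq_one_iff _ _).1 e)

theorem le_two_mul : s + 1 ≤ 2 * l := by
  by_contra hl
  have hpos := h.pos
  have hlt := h.lt
  have hz : genComm a 0 (0 + l) ∈ window a (0 + 1) (0 + l - 1) :=
    h.sys.genComm_mem h.reg (by omega) (by omega)
  have hc : ∀ j, 1 ≤ j → j ≤ 2 * l - 1 → Commute (genComm a 0 (0 + l)) (a j) := by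
    intro j h1 h2
    have h3 : Commute (a l) (a 0 * a j * a 0) :=
      commute_window (i := 0 + 1) (j := 2 * l - 1)
        (fun k hk hk' => h.comm _ _ (by omega) (by omega))
        (h.reg.left_conj 0 (2 * l - 1) (by omega) (by omega) _ (mem_window (by omega) (by omega)))
    have h4 : Commute (a l) (a j) := h.comm _ _ (by omega) (by omega)
    rw [zero_add]
    exact (h.sys.commute_conj_symm h3).mul_left h4
  have := h.mem_min_iter (i := 0 + 1) (i' := l) (by omega) (by omega) (by omega) hz
    (fun k h1 h2 => hc _ (by omega) (by omega))
  rw [window_eq_bot (by omega)] at this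
  exact h.z_ne_one 0 this

theorem z_commute_right {i j : ℤ} (h1 : i < j) (h2 : j < i + s) :
    Commute (genComm a i (i + l)) (a j) := by
  have hpos := h.pos
  have hlt := h.lt
  have hl := h.le_two_mul
  have h3 : Commute (a (i + l)) (a i * a j * a i) :=
    commute_window (i := i + 1) (j := i + s - 1)

        (fun k hk hk' => h.comm _ _ (by omega) (by omega))
      (h.reg.left_conj i (i + s - 1) (by omega) (by omega) _ (mem_window (by omega) (by omega)))
  exact (h.sys.commute_conj_symm h3).mul_left (h.comm _ _ (by omega) (by omega))

theorem z_commute {i j : ℤ} (h1 : i + l - s < j) (h2 : j < i + s) :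
    Commute (genComm a i (i + l)) (a j) := by
  have hpos := h.pos
  rcases lt_or_ge i j with hij | hij
  · exact h.z_commute_right hij h2
  · have := h.neg.z_commute_right (i := -(i + l)) (j := -j) (by omega) (by omega)
    rw [h.neg.sys.genComm_inv _ _ |>.symm, Commute.inv_left_iff] at this
    simpa [genComm] using this

theorem z_mem_left (i : ℤ) : genComm a i (i + l) ∈ window a (i + 1) (i + 2 * l - s) := by
  have hpos := h.pos
  have hlt := h.lt
  have hl := h.le_two_mul
  refine h.mem_max_iter (j := i + l - 1) (by omega) (by omega) (by omega)
    (h.sys.genComm_mem h.reg (by omega) (by omega)) fun k h1 h2 => ?_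
  exact h.z_commute (by omega) (by omega)

theorem z_mem (i : ℤ) : genComm a i (i + l) ∈ window a (i + s - l) (i + 2 * l - s) := by
  have hpos := h.pos
  have hlt := h.lt
  have hl := h.le_two_mul
  refine h.mem_min_iter (i := i + 1) (by omega) (by omega) (by omega) (h.z_mem_left i)
    fun k h1 h2 => ?_
  exact h.z_commute (by omega) (by omega)

theorem two_mul_le : 2 * s ≤ 3 * l := by
  by_contra hl
  have := h.z_mem 0
  rw [window_eq_bot (by omega)] at this
  exact h.z_ne_one 0 this

theorem sq_window {i j : ℤ} (hij : j - i < l) {w : G} (hw : w ∈ window a i j) : w * w = 1 := by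
  have hcomm : ∀ x ∈ window a i j, ∀ y ∈ window a i j, Commute x y := fun x hx y hy =>
    commute_window (fun k h1 h2 => (commute_window (fun k' h3 h4 =>
      h.comm _ _ (by omega) (by omega)) hx).symm) hy
  induction hw using Subgroup.closure_induction with
  | mem x hx => obtain ⟨k, -, rfl⟩ := hx; exact h.sys.sq k
  | one => simp
  | mul x y hx hy ihx ihy =>
    rw [(hcomm y hy x hx).mul_mul_mul_comm, ihx, ihy, one_mul]
  | inv x _ ih => rw [← mul_inv_rev, ih, inv_one]

theorem z_ne {i e : ℤ} (hie : i < e) (he : e - i ≤ s - l) :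
    genComm a i (i + l) ≠ genComm a e (e + l) := by
  intro heq
  have hpos := h.pos
  have key : ∀ c : ℕ, (c : ℤ) ≤ l - 1 →
      genComm a e (e + l) ∈ window a (e + 1) (e + (l - 1 - c)) := by
    intro c
    induction c with
    | zero =>
      intro _
      have := h.sys.genComm_mem h.reg (i := e) (j := e + l) (by omega) (by linarith [h.lt])
      convert this using 2
      push_cast; ring
    | succ c ih =>
      intro hc
      push_cast at hc ⊢
      have ih := ih (by omega)
      have h1 : genComm a i (i + l) ∈ window a (i + 1) (i + (l - 1 - c)) := by
        rw [← h.sys.conj_window_mem_iff (e - i), h.sys.genComm_conj]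
        convert ih using 2 <;> ring_nf
      rw [heq] at h1
      have e1 : e + (l - 1 - (c + 1)) = e + (l - 1 - c) - 1 := by ring
      rw [e1]
      rcases h.reg.right_split h.sys (by omega) (by omega) ih with h2 | h2
      · exact h2
      · refine absurd ?_ (h.reg.right_notMem (i + 1) (e + (l - 1 - c)) (by omega) (by omega))
        have : a (e + (l - 1 - c)) = (genComm a e (e + l))⁻¹ *
          (genComm a e (e + l) * a (e + (l - 1 - c))) := by group
        rw [this]
        exact Subgroup.mul_mem _ (Subgroup.inv_mem _ (window_mono le_rfl (by omega) h1))
          (window_mono (by omega) le_rfl h2)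
  have := key (l - 1).toNat (by omega)
  rw [window_eq_bot (by omega)] at this
  exact h.z_ne_one e this

end ShiftContext

end Context

section Central

variable {G : Type*} [Group G] {τ : G} {a : ℤ → G} {s l : ℤ}

theorem ShiftSystem.commute_of_conj (h : ShiftSystem τ a) {i : ℤ} {g : G}
    (hg : a i * g * a i = g) : Commute (a i) g := by
  rw [commute_iff_eq]
  nth_rw 2 [← hg]
  rw [mul_assoc, h.sq, mul_one]

theorem ShiftSystem.conj_of_commute (h : ShiftSystem τ a) {i : ℤ} {g : G}
    (hg : Commute (a i) g) : a i * g * a i = g := by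
  rw [hg.eq, mul_assoc, h.sq, mul_one]

namespace ShiftContext

variable (h : ShiftContext τ a s l)
include h

theorem genComm_mem_of_centralComm {i e m : ℤ} (hie : i < e) (hem : e < m - l) (hm : m - i < s)
    (hS : CentralComm a (m - i - 1)) : genComm a e m ∈ window a (e + 1) (i + l) := by
  have hpos := h.pos
  have hlt := h.lt
  have hl := h.le_two_mul
  refine h.mem_max_iter (j := m - 1) (by omega) (by omega) (by omega)
    (h.sys.genComm_mem h.reg (by omega) (by omega)) fun k h1 h2 => ?_
  exact hS e m _ (by omega) (by omega) (by omega) (by omega)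

theorem conj_genComm {i e m : ℤ} (hie : i < e) (hem : e ≤ m - l) (hm : m - i < s)
    (hS : CentralComm a (m - i - 1)) : Commute (genComm a e m) (a i) ∨
      a i * genComm a e m * a i = genComm a e m * genComm a i (i + l) := by
  have hpos := h.pos
  have hlt := h.lt
  have hl := h.le_two_mul
  rcases eq_or_lt_of_le hem with heq | hem
  · left
    rw [show m = e + l by omega]
    exact h.z_commute (by omega) (by omega)
  have hmem := h.genComm_mem_of_centralComm hie hem hm hS
  set y := genComm a e m
  rcases lt_or_ge (i + l) (e + 1) with hb | hb
  · left
    rw [window_eq_bot hb, Subgroup.mem_bot] at hmem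
    rw [hmem]; exact Commute.one_left _
  have hcom : ∀ u ∈ window a (e + 1) (i + l - 1), Commute (a i) u := fun u hu =>
    commute_window (fun k h1 h2 => h.comm _ _ (by omega) (by omega)) hu
  rcases h.reg.right_split h.sys hb (by omega) hmem with hu | hu
  · exact .inl (hcom _ hu).symm
  · right
    have hc := hcom _ hu
    have hz : Commute (genComm a i (i + l)) (a (i + l)) := h.z_commute (by omega) (by omega)
    have e1 : y = (y * a (i + l)) * a (i + l) := by rw [mul_assoc, h.sys.sq, mul_one]
    have e2 : genComm a i (i + l) = a (i + l) * genComm a i (i + l) * a (i + l) := by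
      rw [← hz.eq, mul_assoc, h.sys.sq, mul_one]
    have e3 : a i * a (i + l) * a i = genComm a i (i + l) * a (i + l) := by
      simp only [genComm, mul_assoc, h.sys.sq, mul_one]
    calc a i * y * a i = (a i * (y * a (i + l))) * (a (i + l) * a i) := by
          conv_lhs => rw [e1]
          simp only [mul_assoc]
      _ = (y * a (i + l)) * (a i * a (i + l) * a i) := by rw [hc.eq]; simp only [mul_assoc]
      _ = y * (a (i + l) * genComm a i (i + l) * a (i + l)) := by rw [e3]; simp only [mul_assoc]
      _ = _ := by rw [← e2]

theorem conj_genComm_inv {i e m : ℤ} (hie : i < e) (hem : e ≤ m - l) (hm : m - i < s)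
    (hS : CentralComm a (m - i - 1)) :
    (Commute (genComm a i m) (a e) ∧ Commute (genComm a e m) (a i)) ∨
      a e * (genComm a i m)⁻¹ * a e * genComm a i m = genComm a i (i + l) := by
  have hpos := h.pos
  have hlt := h.lt
  have hl := h.le_two_mul
  have hc : a i * a e = a e * a i := (h.comm i e (by omega) (by omega)).eq
  have hz : Commute (genComm a i (i + l)) (a m) := h.z_commute (by omega) (by omega)
  have key : (genComm a e m)⁻¹ * (a i * genComm a e m * a i) =
      a m * (a e * (genComm a i m)⁻¹ * a e * genComm a i m) * a m := by
    have hc' : ∀ g, a i * (a e * g) = a e * (a i * g) := fun g => by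
      rw [← mul_assoc, hc, mul_assoc]
    simp only [genComm, mul_inv_rev, h.sys.inv, mul_assoc, h.sys.mul_self_mul, h.sys.sq, mul_one,
      hc']
  rcases h.conj_genComm hie hem hm hS with h1 | h1
  · left
    refine ⟨?_, h1⟩
    have h2 : a i * genComm a e m * a i = genComm a e m := by
      rw [← h1.eq, mul_assoc, h.sys.sq, mul_one]
    rw [h2, inv_mul_cancel] at key
    have h3 : a e * (genComm a i m)⁻¹ * a e * genComm a i m = 1 := by
      have : a m * 1 * a m = 1 := by rw [mul_one, h.sys.sq]
      rw [← this, key]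
      simp only [mul_assoc, h.sys.mul_self_mul, h.sys.sq, mul_one]
    rw [mul_eq_one_iff_eq_inv] at h3
    exact Commute.inv_left_iff.1 (h.sys.commute_of_conj h3).symm
  · right
    rw [h1, inv_mul_cancel_left] at key
    have : genComm a i (i + l) = a m * genComm a i (i + l) * a m := by
      rw [← hz.eq, mul_assoc, h.sys.sq, mul_one]
    rw [this, key]
    simp only [mul_assoc, h.sys.mul_self_mul, h.sys.sq, mul_one]

theorem genComm_conj_self (i m : ℤ) : a i * genComm a i m * a i = (genComm a i m)⁻¹ := by
  simp only [genComm, mul_inv_rev, h.sys.inv, mul_assoc, h.sys.mul_self_mul]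

theorem genComm_mem_left {i m : ℤ} (hl : l ≤ m - i) (hm : m - i < s)
    (hS : CentralComm a (m - i - 1)) : genComm a i m ∈ window a (i + 1) (i + l - 1) := by
  have hpos := h.pos
  have hlt := h.lt
  have hl2 := h.le_two_mul
  suffices ∀ j, i + l - 1 ≤ j → j ≤ m - 1 → genComm a i m ∈ window a (i + 1) j →
      genComm a i m ∈ window a (i + 1) (i + l - 1) from
    this (m - 1) (by omega) le_rfl (h.sys.genComm_mem h.reg (by omega) (by omega))
  intro j hj
  induction j, hj using Int.leInduction with
  | base => exact fun _ hy => hy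
  | succ j hj ih =>
    intro hjm hy
    refine ih (by omega) ?_
    set y := genComm a i m with hy_def
    have hys : a i * y * a i = y⁻¹ := h.genComm_conj_self i m
    rcases h.reg.right_split h.sys (by omega) (by omega) hy with hu | hu
    · rwa [add_sub_cancel_right] at hu
    obtain ⟨e, he⟩ : ∃ e, j + 1 = e + l := ⟨j + 1 - l, by ring⟩
    rcases eq_or_lt_of_le (show i ≤ e by omega) with rfl | hie
    · have h1 : y⁻¹ = y := inv_eq_of_mul_eq_one_left (h.sq_window (by omega) hy)
      rw [h1] at hys
      have := h.mem_max (by omega) (by omega) hy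
        (by rw [he, add_sub_cancel_right]; exact (h.sys.commute_of_conj hys).symm)
      rwa [add_sub_cancel_right] at this
    · exfalso
      rw [he] at hu
      set w := y * a (e + l) with hw
      have hc : Commute (a e) w :=
        commute_window (fun k h1 h2 => h.comm _ _ (by omega) (by omega)) hu
      have hyw : y = w * a (e + l) := by rw [hw, mul_assoc, h.sys.sq, mul_one]
      have hcw : a e * w⁻¹ * a e = w⁻¹ := h.sys.conj_of_commute hc.inv_right
      have hz : Commute (genComm a e (e + l)) (a (e + l)) := h.z_commute (by omega) (by omega)
      have key : a e * y⁻¹ * a e * y = genComm a e (e + l) := by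
        calc a e * y⁻¹ * a e * y
            = a e * a (e + l) * a e * (a e * w⁻¹ * a e) * w * a (e + l) := by
              rw [hyw]
              simp only [mul_inv_rev, h.sys.inv, mul_assoc, h.sys.mul_self_mul]
          _ = _ := by rw [hcw]; simp only [genComm, mul_assoc, inv_mul_cancel_left]
      rcases h.conj_genComm_inv hie (by omega) hm hS with h1 | h1
      · rw [h.sys.conj_of_commute h1.1.symm.inv_right, inv_mul_cancel] at key
        exact h.z_ne_one e key.symm
      · exact h.z_ne hie (by omega) (h1.symm.trans key)

theorem genComm_commute_of_mem {i m j : ℤ} (hl : l ≤ m - i) (hm : m - i < s)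
    (hS : CentralComm a (m - i - 1)) (h1 : i ≤ j) (h2 : j ≤ m) :
    Commute (genComm a i m) (a j) := by
  have hl2 := h.le_two_mul
  rcases le_or_gt j (i + l) with hj | hj
  · exact (commute_window (fun k h1 h2 => h.comm _ _ (by omega) (by omega))
      (h.genComm_mem_left hl hm hS)).symm
  · have hS' : CentralComm (fun i => a (-i)) (-i - -m - 1) := by
      rw [show -i - -m - 1 = m - i - 1 by ring]
      exact hS.neg h.sys
    have := h.neg.genComm_mem_left (i := -m) (m := -i) (by omega) (by omega) hS'
    have h3 : Commute (a (-(-j))) _ :=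
      commute_window (fun k h1 h2 => h.neg.comm (-j) _ (by omega) (by omega)) this
    rw [← h.neg.sys.genComm_inv, Commute.inv_right_iff] at h3
    simpa [genComm] using h3.symm

theorem genComm_commute_left {i m k : ℤ} (hk : k < s) (hS : CentralComm a (k - 1)) (hlk : l ≤ k)
    (h1 : i ≤ m) (h2 : m - i < k) : Commute (genComm a i m) (a (m - k)) := by
  rcases lt_or_ge (m - i) l with hl | hl
  · rw [(h.sys.genComm_eq_one_iff _ _).2 (h.comm _ _ (by omega) (by omega))]
    exact Commute.one_left _
  have hS' : CentralComm a (m - (m - k) - 1) := by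
    rwa [show m - (m - k) - 1 = k - 1 by ring]
  rcases h.conj_genComm_inv (i := m - k) (e := i) (m := m) (by omega) (by omega) (by omega) hS'
    with h3 | h3
  · exact h3.2
  · have := h.genComm_commute_of_mem (i := m - k) (m := m) (j := i) (by omega) (by omega) hS'
      (by omega) (by omega)
    rw [h.sys.conj_of_commute this.symm.inv_right, inv_mul_cancel] at h3
    exact absurd h3.symm (h.z_ne_one _)

theorem centralComm_succ {k : ℤ} (hk : k < s) (hlk : l ≤ k) (hS : CentralComm a (k - 1)) :
    CentralComm a k := by
  intro i m j h1 h2 h3 h4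
  rcases eq_or_lt_of_le h2 with rfl | h2
  · exact h.genComm_commute_of_mem hlk hk hS (by omega) (by omega)
  rcases eq_or_lt_of_le h3 with rfl | h3
  · exact h.genComm_commute_left hk hS hlk h1 h2
  rcases eq_or_lt_of_le h4 with rfl | h4
  · have := h.neg.genComm_commute_left (i := -m) (m := -i) hk (hS.neg h.sys) hlk (by omega)
      (by omega)
    rw [← h.neg.sys.genComm_inv, Commute.inv_left_iff] at this
    simpa [genComm, add_comm] using this
  · exact hS i m j h1 (by omega) (by omega) (by omega)

theorem centralComm {k : ℤ} (hk : k < s) : CentralComm a k := by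
  rcases lt_or_ge k l with hl | hl
  · intro i m j h1 h2 h3 h4
    rw [(h.sys.genComm_eq_one_iff _ _).2 (h.comm _ _ (by omega) (by omega))]
    exact Commute.one_left _
  · have hl' : l - 1 ≤ k := by omega
    induction k, hl' using Int.leInduction with
    | base => omega
    | succ k hk' ih =>
      refine h.centralComm_succ hk hl ?_
      rw [add_sub_cancel_right]
      rcases lt_or_ge k l with hl' | hl'
      · intro i m j h1 h2 h3 h4
        rw [(h.sys.genComm_eq_one_iff _ _).2 (h.comm _ _ (by omega) (by omega))]
        exact Commute.one_left _
      · exact ih (by omega) hl'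

end ShiftContext

end Central

section Abelian

variable {G : Type*} [Group G] {τ : G} {a : ℤ → G} {s : ℤ}

theorem ShiftSystem.commute_shift (hs : ShiftSystem τ a) (n : ℤ) {i j : ℤ} :
    Commute (a (i + n)) (a (j + n)) ↔ Commute (a i) (a j) := by
  rw [← hs.conj_zpow, ← hs.conj_zpow, commute_iff_eq, commute_iff_eq,
    ← mul_left_cancel_iff (a := (τ ^ n)⁻¹), ← mul_right_cancel_iff (a := τ ^ n)]
  simp [mul_assoc]

theorem exists_shiftContext (hs : ShiftSystem τ a) (hr : RegWindows a s) :
    (∀ i j, i - j < s → j - i < s → Commute (a i) (a j)) ∨ ∃ l, ShiftContext τ a s l := by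
  by_cases h : ∃ d : ℕ, ¬ Commute (a 0) (a d)
  · classical
    set l := Nat.find h with hl
    have h1 : ¬ Commute (a 0) (a l) := Nat.find_spec h
    have hlt : ∀ i j : ℤ, i - j < l → j - i < l → Commute (a i) (a j) := by
      have key : ∀ i j : ℤ, i ≤ j → j - i < l → Commute (a i) (a j) := by
        intro i j hij hj
        obtain ⟨d, rfl⟩ := Int.exists_add_of_le hij
        have := Nat.find_min h (m := d) (by omega)
        rw [not_not, ← hs.commute_shift i, zero_add, add_comm] at this
        exact this
      intro i j h1 h2
      rcases le_total i j with h3 | h3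
      · exact key i j h3 h2
      · exact (key j i h3 h1).symm
    rcases lt_or_ge (l : ℤ) s with hls | hls
    · right
      refine ⟨l, hs, hr, ?_, hls, hlt, fun i hc => h1 ?_⟩
      · rcases Nat.eq_zero_or_pos l with h0 | h0
        · rw [h0] at h1; exact absurd (Commute.refl _) h1
        · exact_mod_cast h0
      · rw [← hs.commute_shift i, zero_add, add_comm]
        exact hc
    · exact .inl fun i j h1 h2 => hlt i j (by omega) (by omega)
  · left
    push Not at h
    have key : ∀ i j : ℤ, i ≤ j → Commute (a i) (a j) := by
      intro i j hij
      obtain ⟨d, rfl⟩ := Int.exists_add_of_le hij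
      have := h d
      rw [← hs.commute_shift i, zero_add, add_comm] at this
      exact this
    intro i j _ _
    rcases le_total i j with h3 | h3
    · exact key i j h3
    · exact (key j i h3).symm

/-- A window containing the next generator contains all of them. -/
theorem ShiftSystem.mem_window_of_right_mem [Finite G] (hs : ShiftSystem τ a) {S : ℤ} (hS : 1 ≤ S)
    (h : a S ∈ window a 0 (S - 1)) (n i : ℤ) : a i ∈ window a n (n + S - 1) := by
  have step : ∀ n, window a (n + 1) (n + S) = window a n (n + S - 1) := by
    intro n
    have := hs.conj_window_mem n h
    rw [hs.conj_zpow] at this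
    have := hs.window_eq_of_right_mem (i := n) (j := n + S - 1) (by
      convert this using 2 <;> ring)
    rwa [sub_add_cancel] at this
  have const : ∀ n, window a n (n + S - 1) = window a 0 (0 + S - 1) := by
    intro n
    induction n using Int.induction_on with
    | zero => rfl
    | succ n ih => rw [← ih, ← step n]; congr 1; ring
    | pred n ih => rw [← ih, ← step (-n - 1)]; congr 1 <;> ring
  rw [const n, ← const i]
  exact mem_window le_rfl (by omega)

theorem RegWindows.commute_of_right_mem [Finite G] (hs : ShiftSystem τ a) (hr : RegWindows a s)
    (hs1 : 1 ≤ s) (h : a s ∈ window a 0 (s - 1)) (i j : ℤ) : Commute (a i) (a j) := by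
  have hmem := fun i => hs.mem_window_of_right_mem hs1 h 0 i
  rcases exists_shiftContext hs hr with hc | ⟨l, hc⟩
  · exact (commute_window (fun k h1 h2 => (commute_window (fun k' h3 h4 =>
      hc _ _ (by omega) (by omega)) (hmem i)).symm) (hmem j))
  · have h1 := hc.le_two_mul
    have h2 := hc.pos
    refine absurd ?_ (hc.not_comm (l - 1))
    exact commute_window (fun k h1 h2 => hc.comm _ _ (by omega) (by omega)) (hmem _)

theorem RegWindows.succ (hs : ShiftSystem τ a) (hr : RegWindows a s) (q : ℤ)
    (h1 : a (q + s) ∉ window a q (q + s - 1))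
    (h2 : ∀ w ∈ window a q (q + s - 1), a (q + s) * w * a (q + s) ∈ window a q (q + s - 1))
    (h3 : a q ∉ window a (q + 1) (q + s))
    (h4 : ∀ w ∈ window a (q + 1) (q + s), a q * w * a q ∈ window a (q + 1) (q + s)) :
    RegWindows a (s + 1) := by
  have key : ∀ k t t' i w, (∀ w ∈ window a t t', a k * w * a k ∈ window a t t') →
      w ∈ window a (t + i) (t' + i) → a (k + i) * w * a (k + i) ∈ window a (t + i) (t' + i) := by
    intro k t t' i w hk hw
    have e : w = τ ^ i * ((τ ^ i)⁻¹ * w * τ ^ i) * (τ ^ i)⁻¹ := by group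
    rw [e, hs.conj_window_mem_iff] at hw
    rw [← hs.conj_zpow i k, e]
    have := hs.conj_window_mem i (hk _ hw)
    convert this using 1
    group
  constructor
  · intro i j hij hj
    rcases lt_or_ge (j - i) s with h | h
    · exact hr.right_notMem i j hij h
    · rw [← hs.conj_window_mem_iff (i - q), hs.conj_zpow] at h1
      convert h1 using 3 <;> ring_nf <;> omega
  · intro i j hij hj w hw
    rcases lt_or_ge (j - i) s with h | h
    · exact hr.right_conj i j hij h w hw
    · have := key _ _ _ (i - q) w h2
      rw [show q + s + (i - q) = j by omega, show q + (i - q) = i by omega,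
        show q + s - 1 + (i - q) = j - 1 by omega] at this
      exact this hw
  · intro i j hij hj
    rcases lt_or_ge (j - i) s with h | h
    · exact hr.left_notMem i j hij h
    · rw [← hs.conj_window_mem_iff (i - q), hs.conj_zpow] at h3
      convert h3 using 3
      all_goals omega
  · intro i j hij hj w hw
    rcases lt_or_ge (j - i) s with h | h
    · exact hr.left_conj i j hij h w hw
    · have := key _ _ _ (i - q) w h4
      rw [show q + s + (i - q) = j by omega, show q + (i - q) = i by omega,
        show q + 1 + (i - q) = i + 1 by omega] at this
      exact this hw

/-- In a group of order less than `4 ^ s`, far apart windows meet nontrivially. -/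
theorem RegWindows.exists_ne_one_mem [Finite G] (hs : ShiftSystem τ a) {S : ℕ}
    (hr : RegWindows a S) (hG : Nat.card G < 2 ^ (2 * S)) (i j : ℤ) :
    ∃ w ∈ window a i (i + S - 1), w ∈ window a j (j + S - 1) ∧ w ≠ 1 := by
  by_contra! h
  have hd : Disjoint (window a i (i + S - 1)) (window a j (j + S - 1)) := by
    rw [Subgroup.disjoint_def]
    exact fun h1 h2 => h _ h1 h2
  have := Nat.card_le_card_of_injective _ (Subgroup.mul_injective_of_disjoint hd)
  rw [Nat.card_prod, hr.card_window hs i S le_rfl, hr.card_window hs j S le_rfl, ← pow_add,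
    ← two_mul] at this
  omega

theorem commutator_mem_centralizer {g c : G} {q : ℤ} (hs : ShiftSystem τ a)
    (hS : CentralComm a (q - 1)) (hg : g ∈ window a 1 q) (hc : c ∈ window a 1 q) :
    Commute (a q * g * a q * g⁻¹) c := by
  have aux : ∀ g ∈ window a 1 q, ∀ c ∈ window a 1 q, Commute (a q * g * a q * g⁻¹) c := by
    intro g hg
    induction hg using Subgroup.closure_induction with
    | mem x hx =>
      obtain ⟨k, ⟨h1, h2⟩, rfl⟩ := hx
      intro c hc
      refine commute_window (fun t h3 h4 => ?_) hc
      have := hS k q t h2 (by omega) (by omega) (by omega)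
      rw [← Commute.inv_left_iff, hs.genComm_inv] at this
      rw [hs.inv]
      exact this
    | one => intro c _; simp [hs.sq]
    | mul x y hx hy ihx ihy =>
      intro c hc
      have e : a q * (x * y) * a q * (x * y)⁻¹ =
          (a q * x * a q * x⁻¹) * (x * (a q * y * a q * y⁻¹) * x⁻¹) := by
        simp only [mul_inv_rev, mul_assoc, inv_mul_cancel_left, hs.mul_self_mul]
      have e2 : x * (a q * y * a q * y⁻¹) * x⁻¹ = a q * y * a q * y⁻¹ := by
        rw [← (ihy x hx).eq, mul_inv_cancel_right]
      rw [e, e2]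
      exact (ihx c hc).mul_left (ihy c hc)
    | inv x hx ih =>
      intro c hc
      have e : a q * x⁻¹ * a q * x⁻¹⁻¹ = x⁻¹ * (a q * x * a q * x⁻¹)⁻¹ * x := by
        simp only [mul_inv_rev, mul_assoc, inv_inv, inv_mul_cancel_left, hs.inv]
      have e2 : x⁻¹ * (a q * x * a q * x⁻¹)⁻¹ * x = (a q * x * a q * x⁻¹)⁻¹ := by
        rw [mul_assoc, ((ih x hx).inv_left).eq, inv_mul_cancel_left]
      rw [e, e2]
      exact (ih c hc).inv_left
  exact aux g hg c hc

end Abelian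

section Main

variable {G : Type*} [Group G] {τ : G} {a : ℤ → G} {s : ℤ}

theorem RegWindows.commute_of_mem_inter (hs : ShiftSystem τ a) (hr : RegWindows a s) {q : ℤ}
    {g r : G} (hq : 1 ≤ q) (hqs : q ≤ s) (hg : g ∈ window a 1 q)
    (hr' : r ∈ window a (q + 1) (s + q - 1)) (hgr : g = r * a (s + q))
    (hdisj : ∀ w ∈ window a 1 q, w ∈ window a (q + 1) (s + q - 1) → w = 1) :
    Commute (a q) g := by
  rcases exists_shiftContext hs hr with hc | ⟨l, h⟩
  · exact commute_window (fun k h1 h2 => hc _ _ (by omega) (by omega)) hg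
  rcases lt_or_ge (q - 1) l with hlq | hlq
  · exact commute_window (fun k h1 h2 => h.comm _ _ (by omega) (by omega)) hg
  have hpos := h.pos
  have hlt := h.lt
  have hl := h.le_two_mul
  set ζ := a q * g * a q * g⁻¹ with hζ
  have hζmem : ζ ∈ window a 1 (q - 1) := by
    rcases hr.right_split hs (by omega) (by omega) hg with h1 | h1
    · exact Subgroup.mul_mem _ (hr.right_conj 1 q (by omega) (by omega) _ h1)
        (Subgroup.inv_mem _ h1)
    · have e : ζ = a q * (g * a q) * a q * (g * a q)⁻¹ := by
        rw [hζ]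
        simp only [mul_inv_rev, mul_assoc, hs.inv, hs.mul_self_mul]
      rw [e]
      exact Subgroup.mul_mem _ (hr.right_conj 1 q (by omega) (by omega) _ h1)
        (Subgroup.inv_mem _ h1)
  have hζc : ∀ k, 1 ≤ k → k ≤ q → Commute ζ (a k) := fun k h1 h2 =>
    commutator_mem_centralizer hs (h.centralComm (by omega)) hg (mem_window h1 h2)
  set R := window a (q + 1) (s + q - 1) with hR
  have hnq : ∀ w ∈ R, a q * w * a q ∈ R := hr.left_conj q (s + q - 1) (by omega) (by omega)
  have hns : ∀ w ∈ R, a (s + q) * w * a (s + q) ∈ R :=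
    hr.right_conj (q + 1) (s + q) (by omega) (by omega)
  have hng : ∀ w ∈ R, g * w * g⁻¹ ∈ R := by
    intro w hw
    have e : g * w * g⁻¹ = r * (a (s + q) * w * a (s + q)) * r⁻¹ := by
      rw [hgr]; simp only [mul_inv_rev, mul_assoc, hs.inv]
    rw [e]
    exact R.mul_mem (R.mul_mem hr' (hns w hw)) (R.inv_mem hr')
  have hng' : ∀ w ∈ R, g⁻¹ * w * g ∈ R := by
    intro w hw
    have e : g⁻¹ * w * g = a (s + q) * (r⁻¹ * w * r) * a (s + q) := by
      rw [hgr]; simp only [mul_inv_rev, mul_assoc, hs.inv]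
    rw [e]
    exact hns _ (R.mul_mem (R.mul_mem (R.inv_mem hr') hw) hr')
  have hnζ : ∀ w ∈ R, ζ * w * ζ⁻¹ ∈ R := by
    intro w hw
    have e : ζ * w * ζ⁻¹ = a q * (g * (a q * (g⁻¹ * w * g) * a q) * g⁻¹) * a q := by
      rw [hζ]; simp only [mul_inv_rev, mul_assoc, hs.inv, inv_inv]
    rw [e]
    exact hnq _ (hng _ (hnq _ (hng' _ hw)))
  have key : ∀ i, 1 ≤ i → i ≤ q → ζ ∈ window a i (q - 1) := by
    intro i hi
    induction i, hi using Int.leInduction with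
    | base => exact fun _ => hζmem
    | succ k hk ih =>
      intro hkq
      have ih := ih (by omega)
      rcases le_or_gt (k + l) q with h1 | h1
      · exact h.mem_min (by omega) (by omega) ih (hζc _ (by omega) h1)
      rcases le_or_gt k (s + q - 2 * l) with h2 | h2
      · rcases hr.left_split hs (by omega) (by omega) ih with h3 | h3
        · exact h3
        exfalso
        refine h.z_ne_one k (hdisj _ ?_ ?_)
        · exact window_mono (by omega) (by omega) (h.z_mem_left k)
        · have h4 : Commute (a (k + l)) (a k * ζ) :=
            commute_window (fun t h1 h2 => h.comm _ _ (by omega) (by omega)) h3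
          have hkl : a (k + l) ∈ R := mem_window (by omega) (by omega)
          have e : genComm a k (k + l) = ζ * a (k + l) * ζ⁻¹ * a (k + l) := by
            have e1 : ζ = a k * (a k * ζ) := by rw [hs.mul_self_mul]
            rw [e1, mul_assoc (a k), ← h4.eq]
            simp only [genComm, mul_assoc, mul_inv_cancel_left, hs.mul_self_mul]
          rw [e]
          exact R.mul_mem (hnζ _ hkl) hkl
      · refine h.mem_min (by omega) (by omega) ih ?_
        have h3 : Commute (a (k + l)) (a q) := h.comm _ _ (by omega) (by omega)
        have h4 : Commute (a (k + l)) r :=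
          commute_window (fun t h1 h2 => h.comm _ _ (by omega) (by omega)) hr'
        have h5 : Commute (a (k + l)) (a (s + q)) := h.comm _ _ (by omega) (by omega)
        have h6 : Commute (a (k + l)) g := by rw [hgr]; exact h4.mul_right h5
        exact (((h3.mul_right h6).mul_right h3).mul_right h6.inv_right).symm
  have h1 := key q hq le_rfl
  rw [window_eq_bot (by omega), Subgroup.mem_bot, hζ, mul_eq_one_iff_eq_inv, inv_inv] at h1
  exact hs.commute_of_conj h1

theorem RegWindows.succ_of_notMem [Finite G] (hs : ShiftSystem τ a) {S : ℕ}
    (hr : RegWindows a S) (hG : Nat.card G < 2 ^ (2 * S)) (hS1 : 1 ≤ S)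
    (hS : a S ∉ window a 0 (S - 1)) : RegWindows a (S + 1) := by
  set s : ℤ := (S : ℤ) with hs_def
  have hright : ∀ i, a (i + s) ∉ window a i (i + s - 1) := by
    intro i hi
    rw [show i + s = s + i by ring, ← hs.conj_zpow, show window a i (s + i - 1) =
      window a (0 + i) (s - 1 + i) by congr 1 <;> ring, hs.conj_window_mem_iff] at hi
    exact hS hi
  have hleft : ∀ i, a i ∉ window a (i + 1) (i + s) := by
    intro i hi
    have h1 : window a i (i + s - 1) = window a (i + 1) (i + s) := by
      apply Subgroup.eq_of_le_of_card_ge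
      · refine window_le fun k h₁ h₂ => ?_
        rcases eq_or_lt_of_le h₁ with rfl | h₁
        · exact hi
        · exact mem_window (by omega) (by omega)
      · have := hs.card_window_shift 1 i (i + s - 1)
        rw [sub_add_cancel] at this
        exact this.le
    refine hright i ?_
    rw [h1]
    exact mem_window (by omega) le_rfl
  -- consecutive windows of length `s` meet in the obvious subgroup
  have hcons : ∀ i w, w ∈ window a i (i + s - 1) → w ∈ window a (i + 1) (i + s) →
      w ∈ window a (i + 1) (i + s - 1) := by
    intro i w h1 h2
    rcases hr.right_split hs (by omega) (by omega) h2 with h3 | h3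
    · exact h3
    · refine absurd ?_ (hright i)
      have e : a (i + s) = w⁻¹ * (w * a (i + s)) := by group
      rw [e]
      exact Subgroup.mul_mem _ (Subgroup.inv_mem _ h1) (window_mono (by omega) le_rfl h3)
  classical
  have hex : ∃ q : ℕ, 1 ≤ q ∧ q ≤ S ∧ ∃ w ∈ window a 1 s, w ∈ window a (q + 1) (s + q) ∧
      w ∉ window a (q + 1) s := by
    obtain ⟨w, h1, h2, h3⟩ := hr.exists_ne_one_mem hs hG 1 (s + 1)
    refine ⟨S, hS1, le_rfl, w, ?_, ?_, ?_⟩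
    · convert h1 using 2; ring
    · convert h2 using 2; rw [← hs_def]; ring
    · rw [window_eq_bot (by omega), Subgroup.mem_bot]; exact h3
  obtain ⟨hq1, hqS, w, hw1, hw2, hw3⟩ := Nat.find_spec hex
  have hmin : ∀ q' : ℤ, 1 ≤ q' → q' < Nat.find hex → ∀ w ∈ window a 1 s,
      w ∈ window a (q' + 1) (s + q') → w ∈ window a (q' + 1) s := by
    intro q' h1 h2 w h3 h4
    obtain ⟨n, rfl⟩ := Int.eq_ofNat_of_zero_le (show 0 ≤ q' by omega)
    have := Nat.find_min hex (m := n) (by omega)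
    push Not at this
    exact this (by omega) (by omega) w h3 h4
  generalize hq : ((Nat.find hex : ℕ) : ℤ) = q at *
  have hq1' : 1 ≤ q := by omega
  have hqs : q ≤ s := by omega
  have hq2 : 2 ≤ q := by
    by_contra hlt
    obtain rfl : q = 1 := by omega
    refine hw3 ?_
    have := hcons 1 w (by convert hw1 using 2; ring) (by convert hw2 using 2; ring)
    convert this using 2; ring
  obtain ⟨g, hg, v, hv, rfl⟩ := hr.exists_mul hs (j := q) (by omega) hqs (by omega) hw1
  have hgq : g ∈ window a (q + 1) (s + q) := by
    have := Subgroup.mul_mem _ hw2 (Subgroup.inv_mem _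
      (window_mono le_rfl (show s ≤ s + q by omega) hv))
    rwa [mul_inv_cancel_right] at this
  have hg1 : g ≠ 1 := by
    rintro rfl
    rw [one_mul] at hw3
    exact hw3 hv
  have hF : ∀ w ∈ window a 1 q, w ∈ window a q (s + q - 1) → w ∈ window a (q + 1) (s + q) →
      w = 1 := by
    intro w h1 h2 h3
    have h4 := hmin (q - 1) (by omega) (by omega) w (window_mono le_rfl (by omega) h1)
      (by convert h2 using 2 <;> ring)
    rw [sub_add_cancel] at h4
    rcases hr.left_split hs hqs (by omega) h4 with h5 | h5
    · exact hr.eq_one_of_mem hs (by omega) hqs (by omega) h1 h5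
    · refine absurd ?_ (hleft q)
      have e : a q = (a q * w) * w⁻¹ := by group
      rw [e, add_comm q s]
      exact Subgroup.mul_mem _ (window_mono le_rfl (by omega) h5) (Subgroup.inv_mem _ h3)
  have hR : g * a (s + q) ∈ window a (q + 1) (s + q - 1) := by
    rcases hr.right_split hs (by omega) (by omega) hgq with h1 | h1
    · exact absurd (hF g hg (window_mono (by omega) le_rfl h1) hgq) hg1
    · exact h1
  set r := g * a (s + q) with hrdef
  have hgr : g = r * a (s + q) := by rw [hrdef, mul_assoc, hs.sq, mul_one]
  have hcomm : Commute (a q) g := hr.commute_of_mem_inter hs hq1' hqs hg hR hgr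
    fun w h1 h2 => hF w h1 (window_mono (by omega) le_rfl h2) (window_mono le_rfl (by omega) h2)
  have hnq : ∀ w ∈ window a (q + 1) (s + q - 1), a q * w * a q ∈ window a (q + 1) (s + q - 1) :=
    hr.left_conj q (s + q - 1) (by omega) (by omega)
  have hns : ∀ w ∈ window a (q + 1) (s + q - 1),
      a (s + q) * w * a (s + q) ∈ window a (q + 1) (s + q - 1) :=
    hr.right_conj (q + 1) (s + q) (by omega) (by omega)
  refine hr.succ hs q (hright q) ?_ (hleft q) ?_
  · intro w hw
    rw [add_comm q s] at hw ⊢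
    nth_rw 2 [← hs.inv]
    refine conj_mem_of_window (fun k h1 h2 => ?_) hw
    rcases eq_or_lt_of_le h1 with rfl | h1
    · have e : a (s + q) * a q * (a (s + q))⁻¹ = r⁻¹ * a q * r := by
        have e1 : a (s + q) = r⁻¹ * g := by rw [hgr, inv_mul_cancel_left]
        rw [e1, mul_assoc r⁻¹, ← hcomm.eq]
        simp only [mul_inv_rev, mul_assoc, mul_inv_cancel_left, inv_inv]
      rw [e]
      have hr2 : r ∈ window a q (s + q - 1) := window_mono (by omega) le_rfl hR
      exact Subgroup.mul_mem _ (Subgroup.mul_mem _ (Subgroup.inv_mem _ hr2)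
        (mem_window le_rfl (by omega))) hr2
    · rw [hs.inv]
      exact window_mono (by omega) le_rfl (hns _ (mem_window (by omega) h2))
  · intro w hw
    rw [add_comm q s] at hw ⊢
    nth_rw 2 [← hs.inv]
    refine conj_mem_of_window (fun k h1 h2 => ?_) hw
    rcases eq_or_lt_of_le h2 with rfl | h2
    · have e : a q * a (s + q) * (a q)⁻¹ = (a q * r⁻¹ * a q) * g := by
        have e1 : a (s + q) = r⁻¹ * g := by rw [hgr, inv_mul_cancel_left]
        rw [e1, hs.inv, mul_assoc, mul_assoc, ← hcomm.eq]
        simp only [mul_assoc]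
      rw [e]
      exact Subgroup.mul_mem _ (window_mono le_rfl (by omega)
        (hnq _ (Subgroup.inv_mem _ hR))) hgq
    · rw [hs.inv]
      exact window_mono le_rfl (by omega) (hnq _ (mem_window h1 (by omega)))

/-- If the windows of length `s` are regular and `|G| < 4 ^ s`, all generators commute. -/
theorem RegWindows.commute_of_card_lt [Finite G] (hs : ShiftSystem τ a) {S : ℕ}
    (hr : RegWindows a S) (hG : Nat.card G < 2 ^ (2 * S)) (hS1 : 1 ≤ S) (i j : ℤ) :
    Commute (a i) (a j) := by
  induction hn : Nat.card G - S using Nat.strong_induction_on generalizing S with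
  | _ n ih =>
    by_cases hS : a S ∈ window a 0 (S - 1)
    · exact hr.commute_of_right_mem hs (by exact_mod_cast hS1) hS i j
    · have h1 := hr.succ_of_notMem hs hG hS1 hS
      have h1' : RegWindows a ((S + 1 : ℕ) : ℤ) := by push_cast; exact h1
      have h2 := h1'.card_window hs 0 (S + 1) le_rfl
      have h3 := Subgroup.card_le_card_group (window a 0 (0 + ((S + 1 : ℕ) : ℤ) - 1))
      have h4 : S + 1 < 2 ^ (S + 1) := Nat.lt_two_pow_self
      refine ih (Nat.card G - (S + 1)) (by omega) h1' ?_ (by omega) rfl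
      exact hG.trans_le (Nat.pow_le_pow_right (by omega) (by omega))

/-- Long regular windows contain a generator which commutes with a longer window. -/
theorem RegWindows.exists_commute (hs : ShiftSystem τ a) (hr : RegWindows a s) (h9 : 9 ≤ s) :
    ∃ j, 0 ≤ j ∧ j < s ∧ ∀ k, -1 ≤ k → k ≤ s → Commute (a j) (a k) := by
  rcases exists_shiftContext hs hr with h | ⟨l, h⟩
  · exact ⟨4, by omega, by omega, fun k h1 h2 => h _ _ (by omega) (by omega)⟩
  · have h1 := h.two_mul_le
    have h2 := h.lt
    exact ⟨l - 2, by omega, by omega, fun k h1 h2 => h.comm _ _ (by omega) (by omega)⟩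

end Main

/-- A connected digraph `N` of out-valency two with a group acting faithfully, transitively on
vertices and on arcs, together with an equivariant involution `M` reversing all arcs. -/
structure TransDigraph (G : Type*) {Ω : Type*} [Group G] [MulAction G Ω] (M : Ω → Ω)
    (N : Ω → Ω → Prop) : Prop where
  invol : ∀ x, M (M x) = x
  smul_M : ∀ (g : G) (x : Ω), M (g • x) = g • M x
  smul_N : ∀ (g : G) (x y : Ω), N x y → N (g • x) (g • y)
  rev : ∀ x y, N x y → N (M y) (M x)
  two : ∀ x, ∃ y z, y ≠ z ∧ ∀ w, N x w ↔ w = y ∨ w = z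
  trans : ∀ x y : Ω, ∃ g : G, g • x = y
  swap : ∀ x y y' : Ω, N x y → N x y' → ∃ g : G, g • x = x ∧ g • y = y'
  conn : ∀ S : Set Ω, S.Nonempty → (∀ x ∈ S, M x ∈ S) → (∀ x ∈ S, ∀ y, N x y → y ∈ S) →
    ∀ x, x ∈ S
  faithful : ∀ g : G, (∀ x : Ω, g • x = x) → g = 1

/-- Generators for the vertex stabilizers along a directed path shifted by `τ`. -/
structure PathGenerators {G Ω : Type*} [Group G] [MulAction G Ω]
    (N : Ω → Ω → Prop) (τ : G) (a : ℤ → G) (s : ℕ) (ω : Ω) : Prop where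
  sys : ShiftSystem τ a
  reg : RegWindows a s
  pos : 1 ≤ s
  adj : N ω (τ • ω)
  stab : ∀ (i : ℤ) (g : G), g • τ ^ i • ω = τ ^ i • ω ↔ g ∈ window a (i - s + 1) i
  move : ∀ i : ℤ, a i • τ ^ (i - 1) • ω ≠ τ ^ (i - 1) • ω

section Path

variable {G Ω : Type*} [Group G] [MulAction G Ω] {M : Ω → Ω} {N : Ω → Ω → Prop}

/-- The pointwise stabilizer of the vertices `τ ^ k • ω` with `i ≤ k ≤ j`. -/
def pathStab (τ : G) (ω : Ω) (i j : ℤ) : Subgroup G :=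
  ⨅ k ∈ Set.Icc i j, MulAction.stabilizer G (τ ^ k • ω)

theorem mem_pathStab {τ : G} {ω : Ω} {i j : ℤ} {g : G} :
    g ∈ pathStab τ ω i j ↔ ∀ k, i ≤ k → k ≤ j → g • τ ^ k • ω = τ ^ k • ω := by
  simp [pathStab, Subgroup.mem_iInf, MulAction.mem_stabilizer_iff]

theorem conj_smul_zpow {τ : G} {ω : Ω} {g : G} (n k : ℤ) :
    (τ ^ n * g * (τ ^ n)⁻¹) • τ ^ (k + n) • ω = τ ^ (k + n) • ω ↔ g • τ ^ k • ω = τ ^ k • ω := by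
  rw [add_comm k n, zpow_add, ← smul_smul (τ ^ n), smul_smul _ (τ ^ n),
    inv_mul_cancel_right, ← smul_smul (τ ^ n), (MulAction.injective (τ ^ n)).eq_iff]

theorem conj_mem_pathStab {τ : G} {ω : Ω} {g : G} (n i j : ℤ) :
    τ ^ n * g * (τ ^ n)⁻¹ ∈ pathStab τ ω (i + n) (j + n) ↔ g ∈ pathStab τ ω i j := by
  rw [mem_pathStab, mem_pathStab]
  constructor
  · intro h k h1 h2
    exact (conj_smul_zpow n k).1 (h (k + n) (by omega) (by omega))
  · intro h k h1 h2
    have := (conj_smul_zpow n (k - n)).2 (h (k - n) (by omega) (by omega))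
    rwa [sub_add_cancel] at this

theorem card_pathStab {τ : G} {ω : Ω} (n i j : ℤ) :
    Nat.card (pathStab τ ω (i + n) (j + n)) = Nat.card (pathStab τ ω i j) := by
  have e : (pathStab τ ω i j).map (MulAut.conj (τ ^ n)).toMonoidHom =
      pathStab τ ω (i + n) (j + n) := by
    ext w
    rw [← Subgroup.mem_carrier]
    constructor
    · rintro ⟨v, hv, rfl⟩
      exact (conj_mem_pathStab n i j).2 hv
    · intro hw
      refine ⟨(τ ^ n)⁻¹ * w * τ ^ n, ?_, ?_⟩
      · refine (conj_mem_pathStab n i j).1 ?_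
        convert hw using 1
        group
      · simp only [MulEquiv.toMonoidHom_eq_coe, MonoidHom.coe_coe, MulAut.conj_apply]
        group
  rw [← e]
  exact Nat.card_congr ((pathStab τ ω i j).equivMapOfInjective _
    (MulAut.conj (τ ^ n)).injective).symm.toEquiv

namespace TransDigraph

variable (h : TransDigraph G M N)
include h

theorem op : TransDigraph G M (fun x y => N y x) where
  invol := h.invol
  smul_M := h.smul_M
  smul_N g x y := h.smul_N g y x
  rev x y := h.rev y x
  two x := by
    obtain ⟨y, z, hyz, hw⟩ := h.two (M x)
    refine ⟨M y, M z, fun e => hyz (by rw [← h.invol y, e, h.invol]), fun w => ?_⟩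
    have h1 : N w x ↔ N (M x) (M w) :=
      ⟨h.rev _ _, fun h' => by have := h.rev _ _ h'; rwa [h.invol, h.invol] at this⟩
    have h2 : ∀ u v, M u = v ↔ u = M v := fun u v =>
      ⟨fun e => by rw [← e, h.invol], fun e => by rw [e, h.invol]⟩
    rw [h1, hw, h2, h2]
  trans := h.trans
  swap x y y' h1 h2 := by
    obtain ⟨g, hg, hg'⟩ := h.swap _ _ _ (h.rev _ _ h1) (h.rev _ _ h2)
    have key : ∀ u v, g • M u = M v → g • u = v := fun u v e => by
      rw [← h.invol (g • u), h.smul_M, e, h.invol]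
    exact ⟨g, key _ _ hg, key _ _ hg'⟩
  conn S h1 h2 h3 := h.conn S h1 h2 fun x hx y hxy => by
    have := h2 _ (h3 _ (h2 _ hx) _ (h.rev _ _ hxy))
    rwa [h.invol] at this
  faithful := h.faithful

theorem smul_smul_of_move {g b : G} {x y : Ω} (hxy : N x y) (hg : g • x = x) (hb : b • x = x)
    (hgy : g • y ≠ y) (hby : b • y ≠ y) : g • b • y = y := by
  obtain ⟨p, q, hpq, hw⟩ := h.two x
  have h1 := (hw _).1 hxy
  have h2 := (hw _).1 (by have := h.smul_N g _ _ hxy; rwa [hg] at this)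
  have h3 := (hw _).1 (by have := h.smul_N b _ _ hxy; rwa [hb] at this)
  have h4 := (hw _).1 (by
    have := h.smul_N g _ _ (h.smul_N b _ _ hxy); rwa [hb, hg] at this)
  have h5 : g • b • y ≠ g • y := fun e => hby (MulAction.injective g e)
  grind

theorem smul_smul_self {g : G} {x y : Ω} (hxy : N x y) (hg : g • x = x) : g • g • y = y := by
  by_cases hgy : g • y = y
  · rw [hgy, hgy]
  · exact h.smul_smul_of_move hxy hg hg hgy hgy

theorem fix_other {g : G} {x y z : Ω} (hxy : N x y) (hxz : N x z) (hg : g • x = x)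
    (hy : g • y = y) : g • z = z := by
  by_cases hyz : z = y
  · rw [hyz, hy]
  obtain ⟨p, q, hpq, hw⟩ := h.two x
  have h1 := (hw _).1 hxy
  have h2 := (hw _).1 hxz
  have h3 := (hw _).1 (by have := h.smul_N g _ _ hxz; rwa [hg] at this)
  have h5 : g • z ≠ g • y := fun e => hyz (MulAction.injective g e)
  grind

theorem conj_fix {w b : G} {x y : Ω} (hxy : N x y) (hb : b • x = x) (hw : w • x = x)
    (hy : w • y = y) : (b * w * b⁻¹) • y = y := by
  have h1 : N x (b⁻¹ • y) := by
    have := h.smul_N b⁻¹ _ _ hxy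
    rwa [inv_smul_eq_iff.2 hb.symm] at this
  rw [mul_smul, mul_smul, h.fix_other hxy h1 hw hy, smul_inv_smul]

theorem exists_move {x y : Ω} (hxy : N x y) : ∃ g : G, g • x = x ∧ g • y ≠ y := by
  obtain ⟨p, q, hpq, hw⟩ := h.two x
  have : ∃ z, N x z ∧ z ≠ y := by
    rcases eq_or_ne p y with rfl | hp
    · exact ⟨q, (hw q).2 (.inr rfl), hpq.symm⟩
    · exact ⟨p, (hw p).2 (.inl rfl), hp⟩
  obtain ⟨z, hz, hzy⟩ := this
  obtain ⟨g, hg, rfl⟩ := h.swap _ _ _ hxy hz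
  exact ⟨g, hg, hzy⟩

theorem arc_zpow {τ : G} {ω : Ω} (hω : N ω (τ • ω)) (i : ℤ) :
    N (τ ^ i • ω) (τ ^ (i + 1) • ω) := by
  have := h.smul_N (τ ^ i) _ _ hω
  rwa [smul_smul, ← zpow_add_one] at this

/-- A subgroup fixing a vertex `x`, such that elements of its normalizer carry `x` to all
out- and in-neighbours, is trivial. -/
theorem eq_bot_of_normalizer {H : Subgroup G} {x : Ω} (hH : ∀ g ∈ H, g • x = x)
    (hout : ∀ y, N x y → ∃ g ∈ Subgroup.normalizer (H : Set G), g • x = y)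
    (hin : ∀ y, N y x → ∃ g ∈ Subgroup.normalizer (H : Set G), g • x = y) : H = ⊥ := by
  rw [eq_bot_iff]
  intro k hk
  rw [Subgroup.mem_bot]
  refine h.faithful k fun y => ?_
  have key : ∀ g ∈ Subgroup.normalizer (H : Set G), k • g • x = g • x := by
    intro g hg
    have h1 : g⁻¹ * k * g ∈ H := (Subgroup.mem_normalizer_iff''.1 hg k).1 hk
    have h2 := hH _ h1
    rw [mul_smul, mul_smul, inv_smul_eq_iff] at h2
    exact h2
  have hS := h.conn {y | (∃ g ∈ Subgroup.normalizer (H : Set G), g • x = y) ∨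
    ∃ g ∈ Subgroup.normalizer (H : Set G), g • x = M y} ⟨x, .inl ⟨1, Subgroup.one_mem _, by simp⟩⟩
    (by
      rintro y (hy | hy)
      · right; rwa [h.invol]
      · exact .inl hy)
    (by
      rintro y (⟨g, hg, rfl⟩ | ⟨g, hg, hgy⟩) z hz
      · left
        have := h.smul_N g⁻¹ _ _ hz
        rw [inv_smul_smul] at this
        obtain ⟨g', hg', e⟩ := hout _ this
        exact ⟨g * g', Subgroup.mul_mem _ hg hg', by rw [mul_smul, e, smul_inv_smul]⟩
      · right
        have h1 := h.rev _ _ hz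
        rw [← hgy] at h1
        have := h.smul_N g⁻¹ _ _ h1
        rw [inv_smul_smul] at this
        obtain ⟨g', hg', e⟩ := hin _ this
        exact ⟨g * g', Subgroup.mul_mem _ hg hg', by rw [mul_smul, e, smul_inv_smul]⟩) y
  rcases hS with ⟨g, hg, rfl⟩ | ⟨g, hg, hgy⟩
  · exact key g hg
  · have := key g hg
    rw [hgy, ← h.smul_M] at this
    rw [← h.invol (k • y), this, h.invol]

end TransDigraph

end Path

section Path

variable {G Ω : Type*} [Group G] [MulAction G Ω] {M : Ω → Ω} {N : Ω → Ω → Prop}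

theorem exists_pathStab_le [Finite G] (τ : G) (ω : Ω) :
    ∃ s : ℕ, pathStab τ ω 0 s ≤ pathStab τ ω 0 (s + 1) := by
  by_contra! hlt
  have hle : ∀ s : ℕ, pathStab τ ω 0 (s + 1) ≤ pathStab τ ω 0 s := fun s g hg =>
    mem_pathStab.2 fun k h1 h2 => mem_pathStab.1 hg k h1 (by omega)
  have key : ∀ s : ℕ, Nat.card (pathStab τ ω 0 s) + s ≤ Nat.card (pathStab τ ω 0 (0 : ℕ)) := by
    intro s
    induction s with
    | zero => simp
    | succ s ih =>
      have : Nat.card (pathStab τ ω 0 (s + 1)) < Nat.card (pathStab τ ω 0 s) := by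
        by_contra hc
        exact hlt s (Subgroup.eq_of_le_of_card_ge (hle s) (not_lt.1 hc)).ge
      rw [Nat.cast_succ]
      omega
  have h1 := key (Nat.card (pathStab τ ω 0 (0 : ℕ)))
  generalize Nat.card (pathStab τ ω 0 (0 : ℕ)) = c at h1
  have h2 : 0 < Nat.card (pathStab τ ω 0 (c : ℕ)) := Nat.card_pos
  omega

namespace TransDigraph

variable (h : TransDigraph G M N)
include h

theorem eq_of_ne {x y z w : Ω} (hy : N x y) (hz : N x z) (hw : N x w) (hzy : z ≠ y)
    (hwy : w ≠ y) : z = w := by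
  obtain ⟨p, q, hpq, hN⟩ := h.two x
  have h1 := (hN _).1 hy
  have h2 := (hN _).1 hz
  have h3 := (hN _).1 hw
  grind

theorem pathStab_le_normalizer {τ : G} {ω : Ω} (hω : N ω (τ • ω)) {s : ℕ} (hs : 1 ≤ s)
    {c : G} (hc : c ∈ pathStab τ ω 1 s) :
    c ∈ Subgroup.normalizer (pathStab τ ω 1 (s + 1) : Set G) := by
  have key : ∀ c ∈ pathStab τ ω 1 s, ∀ g ∈ pathStab τ ω 1 (s + 1),
      c * g * c⁻¹ ∈ pathStab τ ω 1 (s + 1) := by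
    intro c hc g hg
    refine mem_pathStab.2 fun k h1 h2 => ?_
    rcases eq_or_lt_of_le h2 with rfl | h2
    · exact h.conj_fix (h.arc_zpow hω s) (mem_pathStab.1 hc _ (by omega) le_rfl)
        (mem_pathStab.1 hg _ (by omega) (by omega)) (mem_pathStab.1 hg _ h1 le_rfl)
    · have e1 := mem_pathStab.1 hc k h1 (by omega)
      rw [mul_smul, mul_smul, inv_smul_eq_iff.2 e1.symm, mem_pathStab.1 hg k h1 (by omega), e1]
  refine Subgroup.mem_normalizer_iff.2 fun g => ⟨key c hc g, fun hg => ?_⟩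
  have := key _ (Subgroup.inv_mem _ hc) _ hg
  convert this using 1
  group

theorem exists_pathGenerators [Finite G] (ω : Ω) :
    ∃ (τ : G) (a : ℤ → G) (s : ℕ), PathGenerators N τ a s ω := by
  classical
  obtain ⟨y, z, -, hy⟩ := h.two ω
  obtain ⟨τ, hτ⟩ := h.trans ω y
  have hω : N ω (τ • ω) := (hy _).2 (.inl hτ)
  have hex := exists_pathStab_le τ ω
  have harc := h.arc_zpow hω
  obtain ⟨s, hs, hmin⟩ : ∃ s : ℕ, pathStab τ ω 0 s ≤ pathStab τ ω 0 (s + 1) ∧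
      ∀ k : ℕ, k < s → ¬ pathStab τ ω 0 k ≤ pathStab τ ω 0 (k + 1) :=
    ⟨Nat.find hex, Nat.find_spec hex, fun k hk => Nat.find_min hex hk⟩
  have hs1 : 1 ≤ s := by
    by_contra h0
    obtain rfl : s = 0 := by omega
    obtain ⟨g, hg1, hg2⟩ := h.exists_move hω
    refine hg2 ?_
    have : g ∈ pathStab τ ω 0 ((0 : ℕ) : ℤ) := mem_pathStab.2 fun k h1 h2 => by
      obtain rfl : k = 0 := by push_cast at h2; omega
      simpa using hg1
    simpa using mem_pathStab.1 (hs this) 1 (by omega) (by simp)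
  obtain ⟨b, hb, hbs⟩ : ∃ b ∈ pathStab τ ω 0 (s - 1), b • τ ^ (s : ℤ) • ω ≠ τ ^ (s : ℤ) • ω := by
    have := hmin (s - 1) (by omega)
    rw [SetLike.not_le_iff_exists] at this
    obtain ⟨b, hb, hb'⟩ := this
    push_cast [hs1] at hb hb'
    rw [sub_add_cancel] at hb'
    refine ⟨b, hb, fun e => hb' (mem_pathStab.2 fun k h1 h2 => ?_)⟩
    rcases eq_or_lt_of_le h2 with rfl | h2
    · exact e
    · exact mem_pathStab.1 hb k h1 (by omega)
  have hHH : pathStab τ ω 0 s = pathStab τ ω 1 (s + 1) := by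
    apply Subgroup.eq_of_le_of_card_ge
    · intro g hg
      exact mem_pathStab.2 fun k h1 h2 => mem_pathStab.1 (hs hg) k (by omega) h2
    · exact (card_pathStab (τ := τ) (ω := ω) 1 0 s).le
  -- a normalizing element fixing `τ • ω` and moving `ω`
  set b' := τ ^ (1 : ℤ) * b * (τ ^ (1 : ℤ))⁻¹ with hb'def
  have hb'1 : b' ∈ pathStab τ ω 1 s := by
    have := (conj_mem_pathStab 1 0 (s - 1)).2 hb
    rwa [zero_add, sub_add_cancel] at this
  have hb's : b' • τ ^ (s + 1 : ℤ) • ω ≠ τ ^ (s + 1 : ℤ) • ω := fun e =>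
    hbs ((conj_smul_zpow 1 _).1 e)
  have hb'0 : b' • τ ^ (0 : ℤ) • ω ≠ τ ^ (0 : ℤ) • ω := by
    intro e
    refine hb's (mem_pathStab.1 (hs (mem_pathStab.2 fun k h1 h2 => ?_)) (s + 1) (by omega) le_rfl)
    rcases eq_or_lt_of_le h1 with rfl | h1
    · exact e
    · exact mem_pathStab.1 hb'1 k (by omega) h2
  have hτn : τ ∈ Subgroup.normalizer (pathStab τ ω 0 s : Set G) := by
    refine Subgroup.mem_normalizer_iff.2 fun g => ?_
    conv_rhs => rw [hHH]
    have := conj_mem_pathStab (τ := τ) (ω := ω) (g := g) 1 0 s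
    rw [zpow_one, zero_add] at this
    exact this.symm
  have hb'n : b' ∈ Subgroup.normalizer (pathStab τ ω 0 s : Set G) := by
    rw [hHH]
    exact h.pathStab_le_normalizer hω hs1 hb'1
  have hcn : ∀ n : ℤ, τ ^ n * b' * (τ ^ n)⁻¹ ∈
      Subgroup.normalizer (pathStab τ ω 0 s : Set G) := fun n =>
    Subgroup.mul_mem _ (Subgroup.mul_mem _ (Subgroup.zpow_mem _ hτn n) hb'n)
      (Subgroup.inv_mem _ (Subgroup.zpow_mem _ hτn n))
  have hbot : pathStab τ ω 0 s = ⊥ := by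
    refine h.eq_bot_of_normalizer (x := ω) (fun g hg => ?_) (fun y hy => ?_) (fun y hy => ?_)
    · simpa using mem_pathStab.1 hg 0 le_rfl (by omega)
    · by_cases hyτ : y = τ • ω
      · exact ⟨τ, hτn, hyτ.symm⟩
      have h1 : (τ ^ (-s : ℤ) * b' * (τ ^ (-s : ℤ))⁻¹) • ω = ω := by
        have := (conj_smul_zpow (τ := τ) (ω := ω) (g := b') (-s) s).2
          (mem_pathStab.1 hb'1 _ (by omega) le_rfl)
        simpa using this
      have h2 : (τ ^ (-s : ℤ) * b' * (τ ^ (-s : ℤ))⁻¹) • τ • ω ≠ τ • ω := by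
        have := (conj_smul_zpow (τ := τ) (ω := ω) (g := b') (-s) (s + 1)).not.2 hb's
        rw [show (s + 1 + -s : ℤ) = 1 by ring, zpow_one] at this
        exact this
      have h3 := h.smul_N (τ ^ (-s : ℤ) * b' * (τ ^ (-s : ℤ))⁻¹) _ _ hω
      rw [h1] at h3
      refine ⟨τ ^ (-s : ℤ) * b' * (τ ^ (-s : ℤ))⁻¹ * τ, Subgroup.mul_mem _ (hcn _) hτn, ?_⟩
      rw [mul_smul]
      exact h.eq_of_ne hω h3 hy h2 hyτ
    · by_cases hyτ : y = τ⁻¹ • ω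
      · exact ⟨τ⁻¹, Subgroup.inv_mem _ hτn, hyτ.symm⟩
      have hω' : N (τ⁻¹ • ω) ω := by simpa using harc (-1)
      have h1 : (τ ^ (-1 : ℤ) * b' * (τ ^ (-1 : ℤ))⁻¹) • ω = ω := by
        have := (conj_smul_zpow (τ := τ) (ω := ω) (g := b') (-1) 1).2
          (mem_pathStab.1 hb'1 _ le_rfl (by omega))
        simpa using this
      have h2 : (τ ^ (-1 : ℤ) * b' * (τ ^ (-1 : ℤ))⁻¹) • τ⁻¹ • ω ≠ τ⁻¹ • ω := by
        have := (conj_smul_zpow (τ := τ) (ω := ω) (g := b') (-1) 0).not.2 hb'0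
        rw [zero_add] at this
        rwa [zpow_neg_one] at this ⊢
      have h3 := h.smul_N (τ ^ (-1 : ℤ) * b' * (τ ^ (-1 : ℤ))⁻¹) _ _ hω'
      rw [h1] at h3
      refine ⟨τ ^ (-1 : ℤ) * b' * (τ ^ (-1 : ℤ))⁻¹ * τ⁻¹,
        Subgroup.mul_mem _ (hcn _) (Subgroup.inv_mem _ hτn), ?_⟩
      rw [mul_smul]
      exact h.op.eq_of_ne hω' h3 hy h2 hyτ
  have hbot' : ∀ i : ℤ, pathStab τ ω i (i + s) = ⊥ := by
    intro i
    have := card_pathStab (τ := τ) (ω := ω) i 0 s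
    rw [hbot, Subgroup.card_bot, zero_add, add_comm] at this
    exact Subgroup.eq_bot_of_card_eq _ this
  set a : ℤ → G := fun i => τ ^ i * b * (τ ^ i)⁻¹ with ha
  have hafix : ∀ i k : ℤ, i ≤ k → k ≤ i + s - 1 → a i • τ ^ k • ω = τ ^ k • ω := by
    intro i k h1 h2
    have := (conj_smul_zpow (τ := τ) (ω := ω) (g := b) i (k - i)).2
      (mem_pathStab.1 hb _ (by omega) (by omega))
    rwa [sub_add_cancel] at this
  have haright : ∀ i : ℤ, a i • τ ^ (i + s) • ω ≠ τ ^ (i + s) • ω := by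
    intro i
    have := (conj_smul_zpow (τ := τ) (ω := ω) (g := b) i s).not.2 hbs
    rwa [add_comm] at this
  have haleft : ∀ i : ℤ, a i • τ ^ (i - 1) • ω ≠ τ ^ (i - 1) • ω := by
    intro i e
    have h1 : a i ∈ pathStab τ ω (i - 1) (i - 1 + s) := mem_pathStab.2 fun k h1 h2 => by
      rcases eq_or_lt_of_le h1 with rfl | h1
      · exact e
      · exact hafix i k (by omega) (by omega)
    rw [hbot', Subgroup.mem_bot] at h1
    refine haright i ?_
    rw [h1, one_smul]
  have hsys : ShiftSystem τ a := by
    constructor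
    · intro i
      have h1 : a i * a i ∈ pathStab τ ω i (i + s) := mem_pathStab.2 fun k h1 h2 => by
        rw [mul_smul]
        rcases eq_or_lt_of_le h2 with rfl | h2
        · have := harc (i + s - 1)
          rw [sub_add_cancel] at this
          exact h.smul_smul_self this (hafix i _ (by omega) le_rfl)
        · rw [hafix i k h1 (by omega), hafix i k h1 (by omega)]
      rwa [hbot'] at h1
    · intro i
      simp only [ha, add_comm i 1, zpow_add, zpow_one]
      group
  have hwin : ∀ i j : ℤ, i - 1 ≤ j → j ≤ i + s - 1 → window a i j = pathStab τ ω j (i + s - 1) := by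
    intro i j hj
    induction j, hj using Int.leInduction with
    | base =>
      intro _
      rw [window_eq_bot (by omega), show i + (s : ℤ) - 1 = i - 1 + s by ring, hbot']
    | succ j hj ih =>
      intro hjs
      have ih := ih (by omega)
      apply le_antisymm
      · exact window_le fun k h1 h2 => mem_pathStab.2 fun t h3 h4 => hafix _ _ (by omega) (by omega)
      · intro g hg
        by_cases hgj : g • τ ^ j • ω = τ ^ j • ω
        · refine window_mono le_rfl (show j ≤ j + 1 by omega) ?_
          rw [ih]
          refine mem_pathStab.2 fun k h1 h2 => ?_
          rcases eq_or_lt_of_le h1 with rfl | h1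
          · exact hgj
          · exact mem_pathStab.1 hg k (by omega) h2
        · have hga : g * a (j + 1) ∈ window a i (j + 1) := by
            refine window_mono le_rfl (show j ≤ j + 1 by omega) ?_
            rw [ih]
            refine mem_pathStab.2 fun k h1 h2 => ?_
            rw [mul_smul]
            rcases eq_or_lt_of_le h1 with rfl | h1
            · have h3 := haleft (j + 1)
              rw [add_sub_cancel_right] at h3
              exact h.op.smul_smul_of_move (harc j) (mem_pathStab.1 hg _ le_rfl hjs)
                (hafix _ _ le_rfl (by omega)) hgj h3
            · rw [hafix _ _ (by omega) (by omega), mem_pathStab.1 hg k (by omega) h2]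
          have e : g = g * a (j + 1) * a (j + 1) := by rw [mul_assoc, hsys.sq, mul_one]
          rw [e]
          exact Subgroup.mul_mem _ hga (mem_window (by omega) le_rfl)
  refine ⟨τ, a, s, hsys, ⟨?_, ?_, ?_, ?_⟩, hs1, hω, ?_, haleft⟩
  · intro i j hij hj hmem
    rw [hwin _ _ (by omega) (by omega)] at hmem
    exact haleft j (mem_pathStab.1 hmem _ le_rfl (by omega))
  · intro i j hij hj w hw
    rw [hwin _ _ (by omega) (by omega)] at hw ⊢
    nth_rw 2 [← hsys.inv]
    refine mem_pathStab.2 fun k h1 h2 => ?_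
    rcases eq_or_lt_of_le h1 with rfl | h1
    · have := harc (j - 1)
      rw [sub_add_cancel] at this
      exact h.op.conj_fix this (hafix _ _ le_rfl (by omega))
        (mem_pathStab.1 hw _ (by omega) (by omega)) (mem_pathStab.1 hw _ le_rfl h2)
    · have e1 := hafix j k (by omega) (by omega)
      rw [mul_smul, mul_smul, inv_smul_eq_iff.2 e1.symm, mem_pathStab.1 hw k (by omega) h2, e1]
  · intro i j hij hj hmem
    rw [hwin _ _ (by omega) (by omega)] at hmem
    exact haright i (mem_pathStab.1 hmem _ (by omega) (by omega))
  · intro i j hij hj w hw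
    rw [hwin _ _ (by omega) (by omega)] at hw ⊢
    nth_rw 2 [← hsys.inv]
    refine mem_pathStab.2 fun k h1 h2 => ?_
    rcases eq_or_lt_of_le h2 with rfl | h2
    · have := harc (i + s - 1)
      rw [sub_add_cancel] at this
      have := h.conj_fix this (hafix i _ (by omega) le_rfl)
        (mem_pathStab.1 hw (i + s - 1) (by omega) (by omega))
        (mem_pathStab.1 hw (i + s) (by omega) (by omega))
      rwa [add_right_comm i 1, add_sub_cancel_right]
    · have e1 := hafix i k (by omega) (by omega)
      rw [mul_smul, mul_smul, inv_smul_eq_iff.2 e1.symm,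
        mem_pathStab.1 hw k (by omega) (by omega), e1]
  · intro i g
    rw [hwin _ _ (by omega) (by omega), mem_pathStab]
    constructor
    · intro hg k h1 h2
      obtain rfl : k = i := by omega
      exact hg
    · intro hg
      exact hg i le_rfl (by omega)

end TransDigraph

end Path

section Cubic

variable {V : Type*} {Γ : SimpleGraph V}

theorem adj_smul_iff (g : Γ ≃g Γ) {x y : V} : Γ.Adj (g • x) (g • y) ↔ Γ.Adj x y :=
  g.map_rel_iff

theorem eq_univ_of_adj_closed (hc : Γ.Connected) {S : Set V} (hS : S.Nonempty)
    (h : ∀ x ∈ S, ∀ y, Γ.Adj x y → y ∈ S) (x : V) : x ∈ S := by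
  obtain ⟨y, hy⟩ := hS
  obtain ⟨p⟩ := hc.preconnected y x
  induction p with
  | nil => exact hy
  | cons hadj _ ih => exact ih (h _ hy _ hadj)

theorem iso_eq_one {g : Γ ≃g Γ} (h : ∀ x : V, g • x = x) : g = 1 :=
  RelIso.ext h

instance finite_iso [Finite V] : Finite (Γ ≃g Γ) := DFunLike.finite _

/-- A connected cubic vertex-transitive graph. -/
structure CubicTransitive (Γ : SimpleGraph V) : Prop where
  conn : Γ.Connected
  three : ∀ v, ∃ x y z, x ≠ y ∧ x ≠ z ∧ y ≠ z ∧ ∀ w, Γ.Adj v w ↔ w = x ∨ w = y ∨ w = z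
  trans : ∀ u v : V, ∃ g : Γ ≃g Γ, g • u = v

/-- The stabilizers of vertices are transitive on neighbours. -/
def LocallyTransitive (Γ : SimpleGraph V) : Prop :=
  ∀ v x y, Γ.Adj v x → Γ.Adj v y → ∃ g : Γ ≃g Γ, g • v = v ∧ g • x = y

namespace CubicTransitive

variable (h : CubicTransitive Γ)
include h

theorem local_cases (v : V) :
    (∀ g : Γ ≃g Γ, g • v = v → ∀ x, Γ.Adj v x → g • x = x) ∨
    (∀ x y, Γ.Adj v x → Γ.Adj v y → ∃ g : Γ ≃g Γ, g • v = v ∧ g • x = y) ∨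
    (∃ x y z, x ≠ y ∧ x ≠ z ∧ y ≠ z ∧ (∀ w, Γ.Adj v w ↔ w = x ∨ w = y ∨ w = z) ∧
      (∀ g : Γ ≃g Γ, g • v = v → g • x = x) ∧ ∃ g : Γ ≃g Γ, g • v = v ∧ g • y = z) := by
  set R : V → V → Prop := fun x y => ∃ g : Γ ≃g Γ, g • v = v ∧ g • x = y with hR
  have refl : ∀ x, R x x := fun x => ⟨1, one_smul _ _, one_smul _ _⟩
  have symm : ∀ x y, R x y → R y x := by
    rintro x _ ⟨g, hg, rfl⟩
    exact ⟨g⁻¹, inv_smul_eq_iff.2 hg.symm, inv_smul_smul _ _⟩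
  have trans : ∀ x y z, R x y → R y z → R x z := by
    rintro x _ _ ⟨g, hg, rfl⟩ ⟨g', hg', rfl⟩
    exact ⟨g' * g, by rw [mul_smul, hg, hg'], mul_smul _ _ _⟩
  have one : ∀ x y z, (∀ w, Γ.Adj v w ↔ w = x ∨ w = y ∨ w = z) → ¬ R x y → ¬ R x z →
      ∀ g : Γ ≃g Γ, g • v = v → g • x = x := by
    intro x y z hw h1 h2 g hg
    have : Γ.Adj (g • v) (g • x) := (adj_smul_iff g).2 ((hw x).2 (.inl rfl))
    rw [hg, hw] at this
    rcases this with e | e | e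
    · exact e
    · exact absurd ⟨g, hg, e⟩ h1
    · exact absurd ⟨g, hg, e⟩ h2
  obtain ⟨x, y, z, hxy, hxz, hyz, hw⟩ := h.three v
  have hw2 : ∀ w, Γ.Adj v w ↔ w = y ∨ w = x ∨ w = z := fun w => by rw [hw]; tauto
  have hw3 : ∀ w, Γ.Adj v w ↔ w = z ∨ w = x ∨ w = y := fun w => by rw [hw]; tauto
  by_cases h1 : R x y <;> by_cases h2 : R x z <;> by_cases h3 : R y z
  · right; left
    intro p q hp hq
    have hp' : R x p := by
      rcases (hw p).1 hp with rfl | rfl | rfl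
      exacts [refl _, h1, h2]
    have hq' : R x q := by
      rcases (hw q).1 hq with rfl | rfl | rfl
      exacts [refl _, h1, h2]
    exact trans _ _ _ (symm _ _ hp') hq'
  · exact absurd (trans _ _ _ (symm _ _ h1) h2) h3
  · exact absurd (trans _ _ _ h1 h3) h2
  · right; right
    exact ⟨z, x, y, hxz.symm, hyz.symm, hxy, hw3,
      one _ _ _ hw3 (fun e => h2 (symm _ _ e)) (fun e => h3 (symm _ _ e)), h1⟩
  · exact absurd (trans _ _ _ h2 (symm _ _ h3)) h1
  · right; right
    exact ⟨y, x, z, hxy.symm, hyz, hxz, hw2,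
      one _ _ _ hw2 (fun e => h1 (symm _ _ e)) h3, h2⟩
  · right; right
    exact ⟨x, y, z, hxy, hxz, hyz, hw, one _ _ _ hw h1 h2, h3⟩
  · left
    intro g hg w hvw
    rcases (hw w).1 hvw with rfl | rfl | rfl
    · exact one _ _ _ hw h1 h2 g hg
    · exact one _ _ _ hw2 (fun e => h1 (symm _ _ e)) h3 g hg
    · exact one _ _ _ hw3 (fun e => h2 (symm _ _ e)) (fun e => h3 (symm _ _ e)) g hg

theorem card_stabilizer_eq [Finite V] (v : V) :
    Nat.card (Γ ≃g Γ) = Nat.card V * Nat.card (MulAction.stabilizer (Γ ≃g Γ) v) := by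
  have : MulAction.IsPretransitive (Γ ≃g Γ) V := ⟨h.trans⟩
  rw [← MulAction.index_stabilizer_of_transitive (Γ ≃g Γ) v, Subgroup.index_mul_card]

/-- The orbit structure of vertex stabilizers on neighbours is the same at all vertices. -/
theorem cases :
    (∀ g : Γ ≃g Γ, ∀ v : V, g • v = v → g = 1) ∨ LocallyTransitive Γ ∨
    (∀ v, ∃ x y z, x ≠ y ∧ x ≠ z ∧ y ≠ z ∧ (∀ w, Γ.Adj v w ↔ w = x ∨ w = y ∨ w = z) ∧
      (∀ g : Γ ≃g Γ, g • v = v → g • x = x) ∧ ∃ g : Γ ≃g Γ, g • v = v ∧ g • y = z) := by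
  by_cases h1 : ∃ v, ∀ g : Γ ≃g Γ, g • v = v → ∀ x, Γ.Adj v x → g • x = x
  · left
    obtain ⟨v, hv⟩ := h1
    have h1 : ∀ u, ∀ g : Γ ≃g Γ, g • u = u → ∀ x, Γ.Adj u x → g • x = x := by
      intro u g hg x hx
      obtain ⟨k, rfl⟩ := h.trans v u
      have h2 := hv (k⁻¹ * g * k) (by rw [mul_smul, mul_smul, hg, inv_smul_smul]) (k⁻¹ • x) (by
        rw [← adj_smul_iff k, smul_inv_smul]; exact hx)
      rwa [mul_smul, mul_smul, smul_inv_smul, (MulAction.injective k⁻¹).eq_iff] at h2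
    intro g u hu
    exact iso_eq_one (eq_univ_of_adj_closed h.conn (S := {x | g • x = x}) ⟨u, hu⟩ fun x hx y hy =>
      h1 x g hx y hy)
  right
  by_cases h2 : ∃ v, ∀ x y, Γ.Adj v x → Γ.Adj v y → ∃ g : Γ ≃g Γ, g • v = v ∧ g • x = y
  · left
    obtain ⟨v, hv⟩ := h2
    intro u x y hx hy
    obtain ⟨k, rfl⟩ := h.trans v u
    obtain ⟨g, hg, e⟩ := hv (k⁻¹ • x) (k⁻¹ • y)
      (by rw [← adj_smul_iff k, smul_inv_smul]; exact hx)
      (by rw [← adj_smul_iff k, smul_inv_smul]; exact hy)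
    refine ⟨k * g * k⁻¹, ?_, ?_⟩
    · rw [mul_smul, mul_smul, inv_smul_smul, hg]
    · rw [mul_smul, mul_smul, e, smul_inv_smul]
  · right
    intro v
    rcases h.local_cases v with h3 | h3 | h3
    · exact absurd ⟨v, h3⟩ h1
    · exact absurd ⟨v, h3⟩ h2
    · exact h3

theorem exists_transDigraph [Finite V]
    (hB : ∀ v, ∃ x y z, x ≠ y ∧ x ≠ z ∧ y ≠ z ∧ (∀ w, Γ.Adj v w ↔ w = x ∨ w = y ∨ w = z) ∧
      (∀ g : Γ ≃g Γ, g • v = v → g • x = x) ∧ ∃ g : Γ ≃g Γ, g • v = v ∧ g • y = z) :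
    ∃ (M : V → V) (N : V → V → Prop), TransDigraph (Γ ≃g Γ) M N ∧
      ∀ x y, Γ.Adj x y ↔ y = M x ∨ N (M x) y := by
  choose M Y Z h1 h2 h3 hw hfix hsw using hB
  have uniq : ∀ v x, Γ.Adj v x → (∀ g : Γ ≃g Γ, g • v = v → g • x = x) → x = M v := by
    intro v x hx hg
    obtain ⟨g, hgv, e⟩ := hsw v
    rcases (hw v x).1 hx with rfl | rfl | rfl
    · rfl
    · exact absurd ((hg g hgv).symm.trans e) (h3 v)
    · have := hg g⁻¹ (inv_smul_eq_iff.2 hgv.symm)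
      rw [inv_smul_eq_iff] at this
      exact absurd (MulAction.injective g (e.trans this)) (h3 v)
  have hadjM : ∀ v, Γ.Adj v (M v) := fun v => (hw v _).2 (.inl rfl)
  have hstab : ∀ v, MulAction.stabilizer (Γ ≃g Γ) v = MulAction.stabilizer (Γ ≃g Γ) (M v) := by
    intro v
    apply Subgroup.eq_of_le_of_card_ge
    · exact fun g hg => hfix v g hg
    · have e := (h.card_stabilizer_eq v).symm.trans (h.card_stabilizer_eq (M v))
      have : 0 < Nat.card V := Nat.card_pos_iff.2 ⟨⟨v⟩, inferInstance⟩
      exact (Nat.eq_of_mul_eq_mul_left this e).ge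
  have hinv : ∀ v, M (M v) = v := by
    intro v
    refine (uniq _ _ (hadjM v).symm fun g hg => ?_).symm
    have : g ∈ MulAction.stabilizer (Γ ≃g Γ) v := by rw [hstab]; exact hg
    exact this
  have hsM : ∀ (g : Γ ≃g Γ) v, M (g • v) = g • M v := by
    intro g v
    refine (uniq _ _ ((adj_smul_iff g).2 (hadjM v)) fun k hk => ?_).symm
    have := hfix v (g⁻¹ * k * g) (by rw [mul_smul, mul_smul, hk, inv_smul_smul])
    rwa [mul_smul, mul_smul, inv_smul_eq_iff] at this
  refine ⟨M, fun x y => Γ.Adj (M x) y ∧ y ≠ x, ⟨hinv, hsM, ?_, ?_, ?_, h.trans, ?_, ?_, ?_⟩, ?_⟩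
  · rintro g x y ⟨e1, e2⟩
    rw [hsM]
    exact ⟨(adj_smul_iff g).2 e1, fun e => e2 (MulAction.injective g e)⟩
  · rintro x y ⟨e1, e2⟩
    rw [hinv]
    refine ⟨e1.symm, fun e => e2 ?_⟩
    rw [← hinv y, ← e, hinv]
  · intro x
    refine ⟨Y (M x), Z (M x), h3 _, fun w => ?_⟩
    have a1 := h1 (M x)
    have a2 := h2 (M x)
    rw [hinv] at a1 a2
    rw [hw, hinv]
    grind
  · rintro x y y' ⟨e1, e2⟩ ⟨e3, e4⟩
    have key : ∀ y, Γ.Adj (M x) y ∧ y ≠ x → ∃ g : Γ ≃g Γ, g • M x = M x ∧ g • Y (M x) = y := by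
      rintro y ⟨b1, b2⟩
      rw [hw, hinv] at b1
      rcases b1 with rfl | rfl | rfl
      · exact absurd rfl b2
      · exact ⟨1, one_smul _ _, one_smul _ _⟩
      · exact hsw _
    obtain ⟨g, hg, rfl⟩ := key y ⟨e1, e2⟩
    obtain ⟨g', hg', rfl⟩ := key y' ⟨e3, e4⟩
    refine ⟨g' * g⁻¹, ?_, ?_⟩
    · have : (g' * g⁻¹) • M x = M x := by
        rw [mul_smul, inv_smul_eq_iff.2 hg.symm, hg']
      have e := hsM (g' * g⁻¹) (M x)
      rwa [this, hinv, eq_comm] at e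
    · rw [mul_smul, inv_smul_smul]
  · intro S hS hM hN
    refine eq_univ_of_adj_closed h.conn hS fun x hx y hxy => ?_
    by_cases e : y = M x
    · rw [e]; exact hM x hx
    · exact hN _ (hM x hx) y ⟨by rwa [hinv], e⟩
  · exact fun g hg => iso_eq_one hg
  · intro x y
    simp only [hinv]
    constructor
    · intro hxy
      by_cases e : y = M x
      · exact .inl e
      · exact .inr ⟨hxy, e⟩
    · rintro (rfl | e)
      · exact hadjM x
      · exact e.1

/-- An element fixing two adjacent vertices and centralizing both their stabilizers. -/
theorem eq_one_of_central (hL : LocallyTransitive Γ) {c : Γ ≃g Γ} {u v : V} (huv : Γ.Adj u v)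
    (hu : c • u = u) (hv : c • v = v) (hcu : ∀ g : Γ ≃g Γ, g • u = u → Commute c g)
    (hcv : ∀ g : Γ ≃g Γ, g • v = v → Commute c g) : c = 1 := by
  set T : Set V := {x | c • x = x ∧ ∀ g : Γ ≃g Γ, g • x = x → Commute c g} with hT
  have key : ∀ x ∈ T, ∀ y ∈ T, Γ.Adj x y → ∀ y', Γ.Adj x y' → y' ∈ T := by
    rintro x ⟨hx, hcx⟩ y ⟨hy, hcy⟩ hxy y' hxy'
    obtain ⟨g, hg, rfl⟩ := hL x y y' hxy hxy'
    have hc := hcx g hg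
    refine ⟨by rw [smul_smul, hc.eq, mul_smul, hy], fun k hk => ?_⟩
    have := hcy (g⁻¹ * k * g) (by rw [mul_smul, mul_smul, hk, inv_smul_smul])
    have h2 := (hc.mul_right this).mul_right hc.inv_right
    have e : g * (g⁻¹ * k * g) * g⁻¹ = k := by group
    rwa [e] at h2
  have hall := eq_univ_of_adj_closed h.conn (S := {x | x ∈ T ∧ ∀ y, Γ.Adj x y → y ∈ T})
    ⟨u, ⟨hu, hcu⟩, key u ⟨hu, hcu⟩ v ⟨hv, hcv⟩ huv⟩ fun x hx y hxy =>
      ⟨hx.2 y hxy, key y (hx.2 y hxy) x hx.1 hxy.symm⟩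
  exact iso_eq_one fun x => (hall x).1.1

end CubicTransitive

end Cubic

section Darts

variable {V : Type*} {Γ : SimpleGraph V}

instance dartAction : MulAction (Γ ≃g Γ) Γ.Dart where
  smul g d := ⟨(g • d.fst, g • d.snd), (adj_smul_iff g).2 d.adj⟩
  one_smul _ := rfl
  mul_smul _ _ _ := rfl

theorem smul_dart_fst (g : Γ ≃g Γ) (d : Γ.Dart) : (g • d).fst = g • d.fst := rfl

theorem dart_ext {d e : Γ.Dart} (h1 : d.fst = e.fst) (h2 : d.snd = e.snd) : d = e :=
  SimpleGraph.Dart.ext _ _ (Prod.ext h1 h2)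

theorem smul_dart_eq_iff {g : Γ ≃g Γ} {d e : Γ.Dart} :
    g • d = e ↔ g • d.fst = e.fst ∧ g • d.snd = e.snd := by
  constructor
  · rintro rfl
    exact ⟨rfl, rfl⟩
  · rintro ⟨h1, h2⟩
    exact dart_ext h1 h2

/-- The dart `e` follows `d` without backtracking. -/
def dartNext (d e : Γ.Dart) : Prop := e.fst = d.snd ∧ e.snd ≠ d.fst

namespace CubicTransitive

variable (h : CubicTransitive Γ)
include h

theorem card_dart_le [Finite V] : Nat.card Γ.Dart ≤ 3 * Nat.card V := by
  classical
  choose X Y Z h1 h2 h3 hw using h.three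
  have : Function.Injective (fun d : Γ.Dart => ((d.fst,
      if d.snd = X d.fst then 0 else if d.snd = Y d.fst then 1 else 2) : V × Fin 3)) := by
    intro d e hde
    have ha := (hw _ _).1 d.adj
    have hb := (hw _ _).1 e.adj
    simp only [Prod.mk.injEq] at hde
    obtain ⟨e1, e2⟩ := hde
    refine dart_ext e1 ?_
    rw [e1] at ha e2
    have := h1 e.fst
    have := h2 e.fst
    have := h3 e.fst
    split_ifs at e2 <;> grind
  have := Nat.card_le_card_of_injective _ this
  rwa [Nat.card_prod, Nat.card_fin, mul_comm] at this

theorem dart_trans (hL : LocallyTransitive Γ) (d e : Γ.Dart) : ∃ g : Γ ≃g Γ, g • d = e := by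
  obtain ⟨g, hg⟩ := h.trans d.fst e.fst
  obtain ⟨k, hk, hk'⟩ := hL e.fst (g • d.snd) e.snd
    (by rw [← hg]; exact (adj_smul_iff g).2 d.adj) e.adj
  refine ⟨k * g, smul_dart_eq_iff.2 ⟨?_, ?_⟩⟩
  · rw [mul_smul, hg, hk]
  · rw [mul_smul, hk']

theorem dart_faithful {g : Γ ≃g Γ} (hg : ∀ d : Γ.Dart, g • d = d) : g = 1 := by
  refine iso_eq_one fun x => ?_
  obtain ⟨y, z, w, -, -, -, hw⟩ := h.three x
  exact (smul_dart_eq_iff.1 (hg ⟨(x, y), (hw y).2 (.inl rfl)⟩)).1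

/-- If the stabilizer of a dart fixes the neighbours of its endpoint, it is trivial. -/
theorem eq_one_of_dart (hL : LocallyTransitive Γ) {d : Γ.Dart}
    (hd : ∀ g : Γ ≃g Γ, g • d = d → ∀ x, Γ.Adj d.snd x → g • x = x) {g : Γ ≃g Γ}
    (hg : g • d = d) : g = 1 := by
  have key : ∀ (e : Γ.Dart) (g : Γ ≃g Γ), g • e = e → ∀ x, Γ.Adj e.snd x → g • x = x := by
    intro e g hg x hx
    obtain ⟨k, rfl⟩ := h.dart_trans hL d e
    have h2 := hd (k⁻¹ * g * k) (by rw [mul_smul, mul_smul, hg, inv_smul_smul]) (k⁻¹ • x) (by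
        rw [← adj_smul_iff k, smul_inv_smul]; exact hx)
    rwa [mul_smul, mul_smul, smul_inv_smul, (MulAction.injective k⁻¹).eq_iff] at h2
  obtain ⟨hg1, hg2⟩ := smul_dart_eq_iff.1 hg
  have hall := eq_univ_of_adj_closed h.conn
    (S := {x | g • x = x ∧ ∀ y, Γ.Adj x y → g • y = y})
    ⟨d.snd, hg2, key d g hg⟩ fun x hx y hxy => ⟨hx.2 y hxy,
      key ⟨(x, y), hxy⟩ g (smul_dart_eq_iff.2 ⟨hx.1, hx.2 y hxy⟩)⟩
  exact iso_eq_one fun x => (hall x).1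

theorem transDigraph_dart (hL : LocallyTransitive Γ)
    (hd : ∀ d : Γ.Dart, ∃ g : Γ ≃g Γ, g • d = d ∧ ∃ x, Γ.Adj d.snd x ∧ g • x ≠ x) :
    TransDigraph (Γ ≃g Γ) (Dart.symm : Γ.Dart → Γ.Dart) dartNext where
  invol := Dart.symm_symm
  smul_M _ _ := rfl
  smul_N g x y := by
    rintro ⟨h1, h2⟩
    exact ⟨by rw [smul_dart_fst, h1]; rfl, fun e => h2 (MulAction.injective g e)⟩
  rev x y := by
    rintro ⟨h1, h2⟩
    exact ⟨h1.symm, fun e => h2 e.symm⟩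
  two d := by
    obtain ⟨x, y, z, h1, h2, h3, hw⟩ := h.three d.snd
    have key : ∀ p q, Γ.Adj d.snd p → Γ.Adj d.snd q → p ≠ q →
        (∀ w, Γ.Adj d.snd w ∧ w ≠ d.fst ↔ w = p ∨ w = q) →
        ∃ y z, y ≠ z ∧ ∀ e, dartNext d e ↔ e = y ∨ e = z := by
      intro p q hp hq hpq hw
      refine ⟨⟨(d.snd, p), hp⟩, ⟨(d.snd, q), hq⟩, fun e => hpq ?_, fun e => ?_⟩
      · exact congrArg (fun d : Γ.Dart => d.snd) e
      · constructor
        · rintro ⟨a1, a2⟩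
          rcases (hw e.snd).1 ⟨a1 ▸ e.adj, a2⟩ with h5 | h5
          · exact .inl (dart_ext a1 h5)
          · exact .inr (dart_ext a1 h5)
        · rintro (rfl | rfl)
          · exact ⟨rfl, ((hw p).2 (.inl rfl)).2⟩
          · exact ⟨rfl, ((hw q).2 (.inr rfl)).2⟩
    have a1 := (hw x).2 (.inl rfl)
    have a2 := (hw y).2 (.inr (.inl rfl))
    have a3 := (hw z).2 (.inr (.inr rfl))
    rcases (hw d.fst).1 d.adj.symm with e | e | e
    · exact key y z a2 a3 h3 fun w => by rw [hw, e]; grind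
    · exact key x z a1 a3 h2 fun w => by rw [hw, e]; grind
    · exact key x y a1 a2 h1 fun w => by rw [hw, e]; grind
  trans := h.dart_trans hL
  swap d e e' := by
    rintro ⟨h1, h2⟩ ⟨h3, h4⟩
    by_cases hee : e = e'
    · exact ⟨1, one_smul _ _, by rw [one_smul, hee]⟩
    obtain ⟨g, hg, x, hx, hgx⟩ := hd d
    refine ⟨g, hg, ?_⟩
    obtain ⟨g1, g2⟩ := smul_dart_eq_iff.1 hg
    refine smul_dart_eq_iff.2 ⟨by rw [h1, h3, g2], ?_⟩
    obtain ⟨p, q, r, n1, n2, n3, hw⟩ := h.three d.snd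
    have b0 := (hw _).1 d.adj.symm
    have b1 := (hw _).1 (h1 ▸ e.adj)
    have b2 := (hw _).1 (h3 ▸ e'.adj)
    have b3 := (hw _).1 hx
    have b4 : e.snd ≠ e'.snd := fun e5 => hee (dart_ext (h1.trans h3.symm) e5)
    have mv : ∀ y, Γ.Adj d.snd y → Γ.Adj d.snd (g • y) := fun y hy => by
      have := (adj_smul_iff g).2 hy
      rwa [g2] at this
    have b5 := (hw _).1 (mv _ hx)
    have b6 := (hw _).1 (mv _ (h1 ▸ e.adj))
    have b7 := (hw _).1 (mv _ (h3 ▸ e'.adj))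
    have inj : ∀ y z : V, g • y = g • z → y = z := fun y z => (MulAction.injective g ·)
    have i1 := inj e.snd e'.snd
    have i2 := inj e.snd d.fst
    have i3 := inj e'.snd d.fst
    generalize d.fst = c0, e.snd = c1, e'.snd = c2 at *
    grind
  conn S hS hM hN := by
    have key : ∀ d ∈ S, ∀ e : Γ.Dart, e.fst = d.fst → e ∈ S := by
      intro d hd e he
      by_cases hde : e = d
      · rwa [hde]
      · exact hN _ (hM d hd) e ⟨he, fun e5 => hde (dart_ext he e5)⟩
    obtain ⟨d, hd⟩ := hS
    have hall := eq_univ_of_adj_closed h.conn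
      (S := {x | ∀ e : Γ.Dart, e.fst = x → e ∈ S}) ⟨d.fst, key d hd⟩ fun x hx y hxy =>
        key _ (hM _ (hx ⟨(x, y), hxy⟩ rfl))
    exact fun e => hall e.fst e rfl
  faithful _ := h.dart_faithful

end CubicTransitive

end Darts

section Darts

variable {V : Type*} {Γ : SimpleGraph V}

namespace CubicTransitive

variable (h : CubicTransitive Γ)
include h

/-- The stabilizer of the common vertex of consecutive darts is generated by their stabilizers. -/
theorem stabilizer_le_of_dartNext
    (hD : TransDigraph (Γ ≃g Γ) (Dart.symm : Γ.Dart → Γ.Dart) dartNext) {d e : Γ.Dart}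
    (hde : dartNext d e) {H : Subgroup (Γ ≃g Γ)} (hd : ∀ g : Γ ≃g Γ, g • d = d → g ∈ H)
    (he : ∀ g : Γ ≃g Γ, g • e = e → g ∈ H) {g : Γ ≃g Γ} (hg : g • d.snd = d.snd) : g ∈ H := by
  obtain ⟨h1, h2⟩ := hde
  have hreach : ∀ x, Γ.Adj d.snd x → ∃ k ∈ H, k • d.snd = d.snd ∧ k • d.fst = x := by
    have hother : ∀ x, Γ.Adj d.snd x → x ≠ e.snd →
        ∃ k ∈ H, k • d.snd = d.snd ∧ k • d.fst = x := by
      intro x hx hxe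
      obtain ⟨k, hk1, hk2⟩ := hD.swap e.symm d.symm ⟨(d.snd, x), hx⟩ ⟨h1.symm, h2.symm⟩
        ⟨h1.symm, hxe⟩
      obtain ⟨e1, e2⟩ := smul_dart_eq_iff.1 hk2
      refine ⟨k, he k ?_, e1, e2⟩
      obtain ⟨e1, e2⟩ := smul_dart_eq_iff.1 hk1
      exact smul_dart_eq_iff.2 ⟨e2, e1⟩
    intro x hx
    by_cases hxe : x = e.snd
    · obtain ⟨p, q, r, n1, n2, n3, hw⟩ := h.three d.snd
      obtain ⟨y, hy1, hy2, hy3⟩ : ∃ y, Γ.Adj d.snd y ∧ y ≠ d.fst ∧ y ≠ e.snd := by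
        have b0 := (hw _).1 d.adj.symm
        have b1 := (hw _).1 (h1 ▸ e.adj)
        by_contra! hcon
        have c1 := hcon p ((hw p).2 (by simp))
        have c2 := hcon q ((hw q).2 (by simp))
        have c3 := hcon r ((hw r).2 (by simp))
        grind
      obtain ⟨k, hk, hk1, hk2⟩ := hother y hy1 hy3
      obtain ⟨l, hl1, hl2⟩ := hD.swap d ⟨(d.snd, y), hy1⟩ e ⟨rfl, hy2⟩ ⟨h1, h2⟩
      have hl := hd l hl1
      obtain ⟨e1, e2⟩ := smul_dart_eq_iff.1 hl1
      obtain ⟨e3, e4⟩ := smul_dart_eq_iff.1 hl2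
      refine ⟨l * k, H.mul_mem hl hk, ?_, ?_⟩
      · rw [mul_smul, hk1, e2]
      · rw [mul_smul, hk2, hxe]
        exact e4
    · exact hother x hx hxe
  have hgx : Γ.Adj d.snd (g • d.fst) := by
    have := (adj_smul_iff g).2 d.adj.symm
    rwa [hg] at this
  obtain ⟨k, hk, hk1, hk2⟩ := hreach _ hgx
  have := hd (k⁻¹ * g) (smul_dart_eq_iff.2 ⟨by rw [mul_smul, ← hk2, inv_smul_smul],
    by rw [mul_smul, hg, inv_smul_eq_iff, hk1]⟩)
  have h3 := H.mul_mem hk this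
  rwa [mul_inv_cancel_left] at h3

theorem lt_nine (hL : LocallyTransitive Γ)
    (hD : TransDigraph (Γ ≃g Γ) (Dart.symm : Γ.Dart → Γ.Dart) dartNext) {τ : Γ ≃g Γ}
    {a : ℤ → Γ ≃g Γ} {s : ℕ} {ω : Γ.Dart} (hP : PathGenerators dartNext τ a s ω) : s < 9 := by
  by_contra! h9
  obtain ⟨j, hj0, hjs, hcomm⟩ := hP.reg.exists_commute hP.sys (by exact_mod_cast h9)
  have hstep : ∀ i : ℤ, dartNext (τ ^ i • ω) (τ ^ (i + 1) • ω) := hD.arc_zpow hP.adj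
  have hcent : ∀ i : ℤ, s - 2 ≤ i → i ≤ s → ∀ g : Γ ≃g Γ, g • τ ^ i • ω = τ ^ i • ω →
      g ∈ Subgroup.centralizer {a j} := by
    intro i h1 h2 g hg
    rw [Subgroup.mem_centralizer_singleton_iff]
    exact (commute_window (fun k h3 h4 => hcomm k (by omega) (by omega))
      ((hP.stab i g).1 hg)).symm.eq
  have hv : ∀ i : ℤ, s - 2 ≤ i → i ≤ s - 1 → ∀ g : Γ ≃g Γ,
      g • (τ ^ i • ω).snd = (τ ^ i • ω).snd → Commute (a j) g := by
    intro i h1 h2 g hg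
    have := h.stabilizer_le_of_dartNext hD (hstep i) (hcent i (by omega) (by omega))
      (hcent (i + 1) (by omega) (by omega)) hg
    rw [Subgroup.mem_centralizer_singleton_iff] at this
    exact this.symm
  obtain ⟨h1, h2⟩ := smul_dart_eq_iff.1
    ((hP.stab (s - 1) (a j)).2 (mem_window (by omega) (by omega)))
  have h3 := (hstep (s - 2)).1
  rw [show (s - 2 + 1 : ℤ) = s - 1 by ring] at h3
  have : a j = 1 := h.eq_one_of_central hL (τ ^ (s - 1 : ℤ) • ω).adj h1 h2
    (fun g hg => hv (s - 2) (by omega) (by omega) g (by rwa [← h3]))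
    (hv (s - 1) (by omega) (by omega))
  exact hP.move j (by rw [this, one_smul])

theorem card_le_of_locallyTransitive [Finite V] (hL : LocallyTransitive Γ) :
    Nat.card (Γ ≃g Γ) ≤ 768 * Nat.card V := by
  have hdc := h.card_dart_le
  obtain ⟨v⟩ := h.conn.nonempty
  obtain ⟨y, z, w, -, -, -, hw⟩ := h.three v
  have : Finite Γ.Dart := Finite.of_injective (fun d : Γ.Dart => (d.fst, d.snd)) fun d e hde =>
    dart_ext (congrArg Prod.fst hde) (congrArg Prod.snd hde)
  set ω : Γ.Dart := ⟨(v, y), (hw y).2 (.inl rfl)⟩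
  have hpre : MulAction.IsPretransitive (Γ ≃g Γ) Γ.Dart := ⟨h.dart_trans hL⟩
  have hcard : ∀ d : Γ.Dart, Nat.card (Γ ≃g Γ) =
      Nat.card Γ.Dart * Nat.card (MulAction.stabilizer (Γ ≃g Γ) d) := fun d => by
    rw [← MulAction.index_stabilizer_of_transitive (Γ ≃g Γ) d, Subgroup.index_mul_card]
  by_cases hd : ∀ d : Γ.Dart, ∃ g : Γ ≃g Γ, g • d = d ∧ ∃ x, Γ.Adj d.snd x ∧ g • x ≠ x
  · have hD := h.transDigraph_dart hL hd
    obtain ⟨τ, a, s, hP⟩ := hD.exists_pathGenerators ω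
    have h9 := h.lt_nine hL hD hP
    have e : MulAction.stabilizer (Γ ≃g Γ) ω = window a (0 - s + 1) 0 := by
      ext g
      have := hP.stab 0 g
      rwa [zpow_zero, one_smul] at this
    have h2 : Nat.card (window a (0 - s + 1) 0) = 2 ^ s := by
      have := hP.reg.card_window hP.sys (0 - s + 1) s le_rfl
      rwa [show (0 - s + 1 + s - 1 : ℤ) = 0 by ring] at this
    rw [hcard ω, e, h2]
    have : 2 ^ s ≤ 2 ^ 8 := Nat.pow_le_pow_right (by norm_num) (by omega)
    nlinarith
  · push Not at hd
    obtain ⟨d, hd⟩ := hd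
    have e : MulAction.stabilizer (Γ ≃g Γ) d = ⊥ := by
      rw [eq_bot_iff]
      exact fun g hg => h.eq_one_of_dart hL hd hg
    rw [hcard d, e, Subgroup.card_bot]
    omega

theorem card_le_or_exists_transDigraph [Finite V] : Nat.card (Γ ≃g Γ) ≤ 768 * Nat.card V ∨
    ∃ (M : V → V) (N : V → V → Prop), TransDigraph (Γ ≃g Γ) M N ∧
      ∀ x y, Γ.Adj x y ↔ y = M x ∨ N (M x) y := by
  rcases h.cases with h1 | h1 | h1
  · left
    obtain ⟨v⟩ := h.conn.nonempty
    have : MulAction.stabilizer (Γ ≃g Γ) v = ⊥ := by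
      rw [eq_bot_iff]
      exact fun g hg => h1 g v hg
    rw [h.card_stabilizer_eq v, this, Subgroup.card_bot]
    omega
  · exact .inl (h.card_le_of_locallyTransitive h1)
  · exact .inr (h.exists_transDigraph h1)

end CubicTransitive

end Darts

section Bits

variable {G : Type*} [Group G] {τ : G} {a : ℤ → G}

/-- The subgroup generated by all generators. -/
def gens (a : ℤ → G) : Subgroup G := Subgroup.closure (Set.range a)

theorem window_le_gens (i j : ℤ) : window a i j ≤ gens a :=
  window_le fun k _ _ => Subgroup.subset_closure ⟨k, rfl⟩

open Classical in
/-- The coordinate at `j` of an element of `gens a`. -/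
noncomputable def bit (a : ℤ → G) (S : ℕ) (j : ℤ) (d : G) : ZMod 2 :=
  if d ∈ window a (j - S + 2) j then 0 else 1

theorem bit_eq_zero {S : ℕ} {j : ℤ} {d : G} : bit a S j d = 0 ↔ d ∈ window a (j - S + 2) j := by
  unfold bit
  split_ifs with h <;> simp [h]

/-- Commuting generators such that windows of length `S` are regular and exhaust `gens a`. -/
structure FullWindows (τ : G) (a : ℤ → G) (S : ℕ) : Prop where
  sys : ShiftSystem τ a
  reg : RegWindows a S
  comm : ∀ i j, Commute (a i) (a j)
  pos : 1 ≤ S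
  full : ∀ n i : ℤ, a i ∈ window a n (n + S - 1)

namespace FullWindows

variable {S : ℕ} (h : FullWindows τ a S)
include h

theorem gens_eq (n : ℤ) : gens a = window a n (n + S - 1) := by
  refine le_antisymm ?_ (window_le_gens _ _)
  rw [gens, Subgroup.closure_le]
  rintro _ ⟨k, rfl⟩
  exact h.full n k

theorem commute {d e : G} (hd : d ∈ gens a) (he : e ∈ gens a) : Commute d e := by
  rw [h.gens_eq 0] at hd he
  exact commute_window (fun k _ _ => (commute_window (fun l _ _ => h.comm k l) hd).symm) he

theorem bit_conj (n j : ℤ) (d : G) : bit a S (j + n) (τ ^ n * d * (τ ^ n)⁻¹) = bit a S j d := by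
  have : τ ^ n * d * (τ ^ n)⁻¹ ∈ window a (j + n - S + 2) (j + n) ↔
      d ∈ window a (j - S + 2) j := by
    rw [show j + n - S + 2 = j - S + 2 + n by ring, h.sys.conj_window_mem_iff]
  classical
  unfold bit
  exact if_congr this rfl rfl

omit h in
theorem bit_one (j : ℤ) : bit a S j 1 = 0 := bit_eq_zero.2 (Subgroup.one_mem _)

theorem bit_gen (j : ℤ) : bit a S j (a (j + 1)) = 1 := by
  unfold bit
  rw [if_neg]
  have h1 := h.pos
  have := h.reg.right_notMem (j - S + 2) (j + 1) (by omega) (by omega)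
  rwa [add_sub_cancel_right] at this

omit h in
theorem bit_gen_of_le {j k : ℤ} (h1 : k ≤ j) (h2 : j ≤ k + S - 2) : bit a S j (a k) = 0 :=
  bit_eq_zero.2 (mem_window (by omega) h1)

theorem bit_mul {d e : G} (hd : d ∈ gens a) (he : e ∈ gens a) (j : ℤ) :
    bit a S j (d * e) = bit a S j d + bit a S j e := by
  set K := window a (j - S + 2) j with hK
  have hpos := h.pos
  have hKD : K ≤ gens a := window_le_gens _ _
  have haK : a (j + 1) ∉ K := fun hc => by
    have := h.bit_gen j
    rw [bit_eq_zero.2 hc] at this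
    exact zero_ne_one this
  have split : ∀ d ∈ gens a, d ∈ K ∨ d * a (j + 1) ∈ K := by
    intro d hd
    rw [h.gens_eq (j - S + 2)] at hd
    have := h.reg.right_split h.sys (i := j - S + 2) (j := j + 1) (by omega) (by omega)
      (by rwa [show j - S + 2 + S - 1 = j + 1 by ring] at hd)
    rwa [add_sub_cancel_right] at this
  have hsq := h.sys.sq (j + 1)
  have hc : Commute e (a (j + 1)) := h.commute he (Subgroup.subset_closure ⟨_, rfl⟩)
  have hmem : d * e ∈ K ↔ (d ∈ K ↔ e ∈ K) := by
    by_cases h1 : d ∈ K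
    · rw [K.mul_mem_cancel_left h1]
      exact (iff_true_left h1).symm
    · by_cases h2 : e ∈ K
      · rw [K.mul_mem_cancel_right h2]
        exact (iff_true_right h2).symm
      · have h3 := K.mul_mem ((split d hd).resolve_left h1) ((split e he).resolve_left h2)
        rw [hc.eq, mul_assoc, ← mul_assoc (a (j + 1)), hsq, one_mul] at h3
        exact iff_of_true h3 (iff_of_false h1 h2)
  unfold bit
  rw [← hK]
  by_cases h1 : d ∈ K <;> by_cases h2 : e ∈ K <;> simp [hmem, h1, h2]
  decide

theorem bit_inv {d : G} (hd : d ∈ gens a) (j : ℤ) : bit a S j d⁻¹ = bit a S j d := by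
  have := h.bit_mul hd (Subgroup.inv_mem _ hd) j
  rw [mul_inv_cancel, bit_one] at this
  generalize bit a S j d = x, bit a S j d⁻¹ = y at *
  revert x y
  decide

theorem mem_window_iff_bit {d : G} (i : ℤ) {q : ℕ} (h1 : 1 ≤ q) (h2 : q ≤ S) :
    d ∈ window a (i - S + 1 + q) i ↔ ∀ j, i ≤ j → j < i + q → bit a S j d = 0 := by
  constructor
  · intro hdw j h3 h4
    exact bit_eq_zero.2 (window_mono (by omega) h3 hdw)
  · induction q, h1 using Nat.le_induction with
    | base =>
      intro hb
      have := bit_eq_zero.1 (hb i le_rfl (by simp))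
      rwa [show i - S + 1 + ((1 : ℕ) : ℤ) = i - S + 2 by push_cast; ring]
    | succ q h1 ih =>
      intro hb
      push_cast at hb ⊢
      have h3 := ih (by omega) fun j h3 h4 => hb j h3 (by omega)
      have h4 := bit_eq_zero.1 (hb (i + q) (by omega) (by omega))
      rcases h.reg.left_split h.sys (by omega) (by omega) h3 with h5 | h5
      · rwa [add_assoc] at h5
      · exfalso
        refine h.reg.left_notMem (i - S + 1 + q) (i + q) (by omega) (by omega) ?_
        have h6 : a (i - S + 1 + q) * d ∈ window a (i - S + 1 + q + 1) (i + q) :=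
          window_mono le_rfl (by omega) h5
        rw [show i + (q : ℤ) - S + 2 = i - S + 1 + q + 1 by ring] at h4
        exact (Subgroup.mul_mem_cancel_right _ h4).1 h6

theorem exists_bits (b : ℤ → ZMod 2) (i : ℤ) {q : ℕ} (hq : q ≤ S) :
    ∃ d ∈ gens a, ∀ j, i ≤ j → j < i + q → bit a S j d = b j := by
  induction q generalizing i with
  | zero => exact ⟨1, Subgroup.one_mem _, fun j h1 h2 => by push_cast at h2; omega⟩
  | succ q ih =>
    push_cast
    obtain ⟨d, hd, hb⟩ := ih (i + 1) (by omega)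
    have ha : a (i + 1) ∈ gens a := Subgroup.subset_closure ⟨_, rfl⟩
    by_cases hi : bit a S i d = b i
    · refine ⟨d, hd, fun j h1 h2 => ?_⟩
      rcases eq_or_lt_of_le h1 with rfl | h1
      · exact hi
      · exact hb j (by omega) (by omega)
    · refine ⟨d * a (i + 1), Subgroup.mul_mem _ hd ha, fun j h1 h2 => ?_⟩
      rw [h.bit_mul hd ha]
      rcases eq_or_lt_of_le h1 with rfl | h1
      · rw [h.bit_gen]
        generalize bit a S i d = x, b i = y at *
        revert x y
        decide
      · rw [bit_gen_of_le (by omega) (by omega), hb j (by omega) (by omega), add_zero]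

omit h in
theorem exists_period [Finite G] : ∃ r : ℕ, 1 ≤ r ∧ ∀ n : ℤ, τ ^ n ∈ gens a ↔ (r : ℤ) ∣ n := by
  obtain ⟨r, hr⟩ := Int.subgroup_cyclic
    ((gens a).toAddSubgroup.comap (zmultiplesHom (Additive G) (Additive.ofMul τ)))
  have key : ∀ n : ℤ, τ ^ n ∈ gens a ↔ ((r.natAbs : ℕ) : ℤ) ∣ n := by
    intro n
    rw [Int.natAbs_dvd, ← Int.mem_zmultiples_iff, ← AddSubgroup.zmultiples_eq_closure] at *
    rw [← hr]
    rfl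
  refine ⟨r.natAbs, Nat.one_le_iff_ne_zero.2 fun h0 => ?_, key⟩
  have := (key (orderOf τ)).1 (by rw [zpow_natCast, pow_orderOf_eq_one]; exact Subgroup.one_mem _)
  rw [h0, Nat.cast_zero, zero_dvd_iff] at this
  exact (orderOf_pos τ).ne' (by exact_mod_cast this)

theorem bit_add_period {r : ℕ} (hr : τ ^ (r : ℤ) ∈ gens a) {d : G} (hd : d ∈ gens a)
    (j t : ℤ) : bit a S (j + r * t) d = bit a S j d := by
  have h1 : τ ^ ((r : ℤ) * t) ∈ gens a := by
    rw [zpow_mul]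
    exact Subgroup.zpow_mem _ hr t
  have := h.bit_conj (r * t) j d
  rwa [(h.commute h1 hd).eq, mul_inv_cancel_right] at this

theorem bit_zpow_period {r : ℕ} (hr : τ ^ (r : ℤ) ∈ gens a) (j t : ℤ) :
    bit a S j (τ ^ ((r : ℤ) * t)) = t * bit a S 0 (τ ^ (r : ℤ)) := by
  have h0 : bit a S j (τ ^ (r : ℤ)) = bit a S 0 (τ ^ (r : ℤ)) := by
    have := h.bit_conj j 0 (τ ^ (r : ℤ))
    rw [zero_add] at this
    rw [← this]
    congr 1
    rw [← zpow_add, ← zpow_neg, ← zpow_add]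
    congr 1
    ring
  rw [zpow_mul]
  induction t using Int.induction_on with
  | zero => simp [bit_one]
  | succ t ih =>
    rw [zpow_add_one, h.bit_mul (Subgroup.zpow_mem _ hr _) hr, ih, h0]
    push_cast
    ring
  | pred t ih =>
    rw [zpow_sub_one, h.bit_mul (Subgroup.zpow_mem _ hr _) (Subgroup.inv_mem _ hr), ih,
      h.bit_inv hr, h0]
    push_cast
    rw [sub_mul, one_mul, sub_eq_add_neg, ZModModule.neg_eq_self (bit a S 0 (τ ^ (r : ℤ)))]

end FullWindows

theorem RegWindows.exists_fullWindows [Finite G] (hs : ShiftSystem τ a) {s : ℕ}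
    (hr : RegWindows a s) (hG : Nat.card G < 2 ^ (2 * s)) (hs1 : 1 ≤ s) :
    ∃ S, s ≤ S ∧ FullWindows τ a S := by
  have hc := hr.commute_of_card_lt hs hG hs1
  induction hn : Nat.card G - s using Nat.strong_induction_on generalizing s with
  | _ n ih =>
    by_cases hS : a s ∈ window a 0 (s - 1)
    · exact ⟨s, le_rfl, hs, hr, hc, hs1, hs.mem_window_of_right_mem (by exact_mod_cast hs1) hS⟩
    · have h1 := hr.succ_of_notMem hs hG hs1 hS
      have hlt : s < Nat.card G := by
        by_contra! hle
        have h2 := hr.card_window hs 0 s le_rfl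
        have h3 := Subgroup.card_le_card_group (window a 0 (0 + s - 1))
        have h4 : s < 2 ^ s := Nat.lt_two_pow_self
        omega
      obtain ⟨S, h2, h3⟩ := ih (Nat.card G - (s + 1)) (by omega) (s := s + 1)
        (by exact_mod_cast h1) (hG.trans (Nat.pow_lt_pow_right (by norm_num) (by omega)))
        (by omega) rfl
      exact ⟨S, by omega, h3⟩

end Bits

section Coding

/-- Codes of vertices: an index, a bit sequence and a side. -/
abbrev Code := ℤ × (ℤ → ZMod 2) × Bool

/-- Codes describing the same vertex. -/
def codeRel (r p : ℕ) (ε : ZMod 2) (u v : Code) : Prop :=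
  u.2.2 = v.2.2 ∧ ∃ t : ℤ, v.1 = u.1 + r * t ∧
    ∀ j, u.1 ≤ j → j < u.1 + p → v.2.1 (j + r * t) = u.2.1 j + t * ε

/-- Adjacency of codes, up to symmetry. -/
def codeEdge (u v : Code) : Prop :=
  (u.1 = v.1 ∧ u.2.1 = v.2.1 ∧ u.2.2 = false ∧ v.2.2 = true) ∨
    (v.1 = u.1 + 1 ∧ u.2.1 = v.2.1 ∧ u.2.2 = true ∧ v.2.2 = false)

/-- A description of a graph by codes. -/
structure IsCoding {V : Type*} (Γ : SimpleGraph V) (r p : ℕ) (ε : ZMod 2) (π : Code → V) :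
    Prop where
  surj : Function.Surjective π
  ker : ∀ u v, π u = π v ↔ codeRel r p ε u v
  adj : ∀ x y, Γ.Adj x y ↔ ∃ u v, π u = x ∧ π v = y ∧ (codeEdge u v ∨ codeEdge v u)

theorem IsCoding.nonempty_iso {V W : Type*} {Γ : SimpleGraph V} {Δ : SimpleGraph W} {r p : ℕ}
    {ε : ZMod 2} {π : Code → V} {ρ : Code → W} (hπ : IsCoding Γ r p ε π)
    (hρ : IsCoding Δ r p ε ρ) : Nonempty (Γ ≃g Δ) := by
  have key : ∀ u v, π u = π v ↔ ρ u = ρ v := fun u v => (hπ.ker u v).trans (hρ.ker u v).symm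
  have h1 := Function.surjInv_eq hπ.surj
  have h2 := Function.surjInv_eq hρ.surj
  refine ⟨⟨⟨fun x => ρ (Function.surjInv hπ.surj x), fun y => π (Function.surjInv hρ.surj y),
    fun x => ?_, fun y => ?_⟩, fun {x y} => ?_⟩⟩
  · exact ((key _ _).2 (h2 _)).trans (h1 x)
  · exact ((key _ _).1 (h1 _)).trans (h2 y)
  · change Δ.Adj (ρ _) (ρ _) ↔ Γ.Adj x y
    rw [hπ.adj, hρ.adj]
    constructor
    · rintro ⟨u, v, hu, hv, huv⟩
      exact ⟨u, v, by rw [(key _ _).2 hu, h1], by rw [(key _ _).2 hv, h1], huv⟩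
    · rintro ⟨u, v, hu, hv, huv⟩
      exact ⟨u, v, (key _ _).1 (by rw [h1, hu]), (key _ _).1 (by rw [h1, hv]), huv⟩

variable {G V : Type*} [Group G] [MulAction G V] {M : V → V} {N : V → V → Prop}
  {τ : G} {a : ℤ → G} {s S : ℕ} {ω : V}

namespace PathGenerators

variable (hP : PathGenerators N τ a s ω) (hF : FullWindows τ a S)
include hP hF

theorem lt_of_fullWindows (h2 : s ≤ S) : s < S := by
  refine lt_of_le_of_ne h2 ?_
  rintro rfl
  have h1 := hF.full 0 s
  refine hP.move s ((hP.stab (s - 1) _).2 ?_)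
  rw [zero_add] at h1
  rwa [show (s - 1 - s + 1 : ℤ) = 0 by ring]

omit hF in
theorem mem_gens {i : ℤ} {g : G} (hg : g • τ ^ i • ω = τ ^ i • ω) : g ∈ gens a :=
  window_le_gens _ _ ((hP.stab i g).1 hg)

theorem stab_iff_bit (hsS : s < S) {i : ℤ} {g : G} : g • τ ^ i • ω = τ ^ i • ω ↔
    ∀ j, i ≤ j → j < i + (S - s : ℕ) → bit a S j g = 0 := by
  rw [hP.stab, ← hF.mem_window_iff_bit i (by omega) (by omega)]
  rw [show i - (S : ℤ) + 1 + ((S - s : ℕ) : ℤ) = i - s + 1 by omega]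

theorem smul_eq_smul_iff (hsS : s < S) {r : ℕ} (hr : ∀ n : ℤ, τ ^ n ∈ gens a ↔ (r : ℤ) ∣ n)
    {d e : G} (hd : d ∈ gens a) (he : e ∈ gens a) (i i' : ℤ) :
    d • τ ^ i • ω = e • τ ^ i' • ω ↔ ∃ t : ℤ, i' = i + r * t ∧ ∀ j, i ≤ j →
      j < i + (S - s : ℕ) →
        bit a S (j + r * t) e = bit a S j d + t * bit a S 0 (τ ^ (r : ℤ)) := by
  have hrr : τ ^ (r : ℤ) ∈ gens a := (hr r).2 dvd_rfl
  have key : ∀ t : ℤ, d • τ ^ i • ω = e • τ ^ (i + r * t) • ω ↔ ∀ j, i ≤ j →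
      j < i + (S - s : ℕ) →
        bit a S (j + r * t) e = bit a S j d + t * bit a S 0 (τ ^ (r : ℤ)) := by
    intro t
    have ht : τ ^ ((r : ℤ) * t) ∈ gens a := (hr _).2 (dvd_mul_right _ _)
    have hdi := Subgroup.inv_mem _ hd
    have h1 : d • τ ^ i • ω = e • τ ^ (i + r * t) • ω ↔
        (d⁻¹ * (e * τ ^ ((r : ℤ) * t))) • τ ^ i • ω = τ ^ i • ω := by
      rw [mul_smul, inv_smul_eq_iff, mul_smul, smul_smul (τ ^ ((r : ℤ) * t)), ← zpow_add,
        add_comm i, eq_comm]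
    rw [h1, hP.stab_iff_bit hF hsS]
    refine forall_congr' fun j => forall_congr' fun _ => forall_congr' fun _ => ?_
    rw [hF.bit_mul hdi (Subgroup.mul_mem _ he ht), hF.bit_mul he ht, hF.bit_inv hd,
      hF.bit_zpow_period hrr, hF.bit_add_period hrr he]
    generalize bit a S j d = x, bit a S j e = y, (t : ZMod 2) * bit a S 0 (τ ^ (r : ℤ)) = z
    revert x y z
    decide
  constructor
  · intro heq
    have h1 : (d⁻¹ * e * τ ^ (i' - i)) • τ ^ i • ω = τ ^ i • ω := by
      rw [mul_smul, mul_smul, smul_smul (τ ^ (i' - i)), ← zpow_add, sub_add_cancel, ← heq,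
        inv_smul_smul]
    have h2 : τ ^ (i' - i) ∈ gens a :=
      (Subgroup.mul_mem_cancel_left _ (Subgroup.mul_mem _ (Subgroup.inv_mem _ hd) he)).1
        (hP.mem_gens h1)
    obtain ⟨t, ht⟩ := (hr _).1 h2
    obtain rfl : i' = i + r * t := by omega
    exact ⟨t, rfl, (key t).1 heq⟩
  · rintro ⟨t, rfl, ht⟩
    exact (key t).2 ht

omit hF in
theorem le_card_of_period [Finite V] {r : ℕ} (hr : ∀ n : ℤ, τ ^ n ∈ gens a ↔ (r : ℤ) ∣ n) :
    r ≤ Nat.card V := by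
  have : Function.Injective (fun k : Fin r => τ ^ (k : ℤ) • ω) := by
    intro k l hkl
    have h1 : τ ^ (l - k : ℤ) • τ ^ (k : ℤ) • ω = τ ^ (k : ℤ) • ω := by
      rw [smul_smul, ← zpow_add, sub_add_cancel]
      exact hkl.symm
    have h2 := (hr _).1 (hP.mem_gens h1)
    have h3 := Int.eq_zero_of_abs_lt_dvd h2 (by rw [abs_lt]; omega)
    exact Fin.ext (by omega)
  simpa using Nat.card_le_card_of_injective _ this

theorem sub_le_card [Finite V] (hsS : s < S) : S - s ≤ Nat.card V := by
  have : Function.Injective (fun k : Fin (S - s) => a ((k : ℤ) + 1) • ω) := by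
    intro k l hkl
    by_contra hne
    wlog hlt : k < l generalizing k l
    · exact this hkl.symm (Ne.symm hne) (lt_of_le_of_ne (not_lt.1 hlt) (Ne.symm hne))
    have ha : ∀ i, a i ∈ gens a := fun i => Subgroup.subset_closure ⟨i, rfl⟩
    have h1 : (a (k + 1) * a (l + 1)) • τ ^ (0 : ℤ) • ω = τ ^ (0 : ℤ) • ω := by
      have e := hkl.symm
      simp only at e
      rw [zpow_zero, one_smul, mul_smul, e, smul_smul, hF.sys.sq, one_smul]
    have h2 := (hP.stab_iff_bit hF hsS).1 h1 l (by omega) (by omega)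
    rw [hF.bit_mul (ha _) (ha _), hF.bit_gen, FullWindows.bit_gen_of_le (by omega) (by omega),
      zero_add] at h2
    exact one_ne_zero h2
  simpa using Nat.card_le_card_of_injective _ this

end PathGenerators

end Coding

section Coding

variable {G V : Type*} [Group G] [MulAction G V] {M : V → V} {N : V → V → Prop}
  {τ : G} {a : ℤ → G} {s S : ℕ} {ω : V}

namespace TransDigraph

variable (h : TransDigraph G M N) (hP : PathGenerators N τ a s ω)
include h hP

omit h in
theorem mul_mem_gens {d g : G} {i : ℤ} (hd : d ∈ gens a)
    (hg : g • d • τ ^ i • ω = d • τ ^ i • ω) : g * d ∈ gens a := by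
  have h1 : (d⁻¹ * g * d) • τ ^ i • ω = τ ^ i • ω := by
    rw [mul_smul, mul_smul, hg, inv_smul_smul]
  have h2 := Subgroup.mul_mem _ hd (hP.mem_gens h1)
  rwa [mul_assoc, mul_inv_cancel_left] at h2

theorem exists_out {d : G} {i : ℤ} {y : V} (hd : d ∈ gens a) (hy : N (d • τ ^ i • ω) y) :
    ∃ e ∈ gens a, e • τ ^ i • ω = d • τ ^ i • ω ∧ e • τ ^ (i + 1) • ω = y := by
  obtain ⟨g, hg, hgy⟩ := h.swap _ _ _ (h.smul_N d _ _ (h.arc_zpow hP.adj i)) hy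
  exact ⟨g * d, mul_mem_gens hP hd hg, by rw [mul_smul, hg], by rw [mul_smul, hgy]⟩

theorem exists_in {d : G} {i : ℤ} {y : V} (hd : d ∈ gens a) (hy : N y (d • τ ^ i • ω)) :
    ∃ e ∈ gens a, e • τ ^ (i - 1) • ω = y := by
  have h1 := h.arc_zpow hP.adj (i - 1)
  rw [sub_add_cancel] at h1
  obtain ⟨g, hg, hgy⟩ := h.op.swap _ _ _ (h.smul_N d _ _ h1) hy
  exact ⟨g * d, mul_mem_gens hP hd hg, by rw [mul_smul, hgy]⟩

theorem exists_code (x : V) :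
    (∃ i : ℤ, ∃ d ∈ gens a, d • τ ^ i • ω = x) ∨
      ∃ i : ℤ, ∃ d ∈ gens a, d • τ ^ i • ω = M x := by
  refine h.conn {x | (∃ i : ℤ, ∃ d ∈ gens a, d • τ ^ i • ω = x) ∨
    ∃ i : ℤ, ∃ d ∈ gens a, d • τ ^ i • ω = M x}
    ⟨ω, .inl ⟨0, 1, Subgroup.one_mem _, by simp⟩⟩ ?_ ?_ x
  · rintro x (hx | hx)
    · right
      rwa [h.invol]
    · exact .inl hx
  · rintro x (⟨i, d, hd, rfl⟩ | ⟨i, d, hd, hx⟩) y hy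
    · obtain ⟨e, he, -, hey⟩ := h.exists_out hP hd hy
      exact .inl ⟨i + 1, e, he, hey⟩
    · have h1 := h.rev _ _ hy
      rw [← hx] at h1
      obtain ⟨e, he, hey⟩ := h.exists_in hP hd h1
      exact .inr ⟨i - 1, e, he, hey⟩

variable (hF : FullWindows τ a S)
include hF

omit hP in
theorem fix_iff {c g : G} {i j : ℤ} (hc : c ∈ gens a) (hM : M (τ ^ i • ω) = c • τ ^ j • ω)
    (hg : g ∈ gens a) : g • τ ^ i • ω = τ ^ i • ω ↔ g • τ ^ j • ω = τ ^ j • ω := by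
  have h1 : g • τ ^ i • ω = τ ^ i • ω ↔ g • M (τ ^ i • ω) = M (τ ^ i • ω) := by
    rw [← h.smul_M]
    exact ⟨congrArg M, fun e => by rw [← h.invol (g • τ ^ i • ω), e, h.invol]⟩
  rw [h1, hM, smul_smul, (hF.commute hg hc).eq, mul_smul, (MulAction.injective c).eq_iff]

theorem M_ne {d e : G} (hs : 2 ≤ s) (hd : d ∈ gens a) (he : e ∈ gens a) (i j : ℤ) :
    M (d • τ ^ i • ω) ≠ e • τ ^ j • ω := by
  intro heq
  have hc : d⁻¹ * e ∈ gens a := Subgroup.mul_mem _ (Subgroup.inv_mem _ hd) he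
  have h1 : M (τ ^ i • ω) = (d⁻¹ * e) • τ ^ j • ω := by
    rw [mul_smul, ← heq, h.smul_M d, inv_smul_smul]
  obtain ⟨c, hc', h2⟩ : ∃ c ∈ gens a, c • τ ^ (j - 1) • ω = M (τ ^ (i + 1) • ω) := by
    have := h.rev _ _ (h.arc_zpow hP.adj i)
    rw [h1] at this
    exact h.exists_in hP hc this
  have ha : ∀ i, a i ∈ gens a := fun i => Subgroup.subset_closure ⟨i, rfl⟩
  have h3 : a (j - 1) • τ ^ i • ω = τ ^ i • ω :=
    (h.fix_iff hF hc h1 (ha _)).2 ((hP.stab _ _).2 (mem_window (by omega) (by omega)))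
  have h4 : a j • τ ^ (i + 1) • ω = τ ^ (i + 1) • ω := by
    have := (conj_smul_zpow (τ := τ) (ω := ω) (g := a (j - 1)) 1 i).2 h3
    rwa [hF.sys.conj_zpow, sub_add_cancel] at this
  exact hP.move j ((h.fix_iff hF hc' h2.symm (ha _)).1 h4)

theorem exists_isCoding [Finite G] [Finite V] {Γ : SimpleGraph V}
    (hΓ : ∀ x y, Γ.Adj x y ↔ y = M x ∨ N (M x) y) (hs : 2 ≤ s) (hsS : s < S) :
    ∃ r ≤ Nat.card V, ∃ p ≤ Nat.card V, ∃ ε π, IsCoding Γ r p ε π := by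
  obtain ⟨r, -, hr⟩ := FullWindows.exists_period (τ := τ) (a := a)
  have hexD := fun (i : ℤ) (b : ℤ → ZMod 2) => hF.exists_bits b i (q := S - s + 1) (by omega)
  choose D hD hbits using hexD
  set P : ℤ → (ℤ → ZMod 2) → V := fun i b => D i b • τ ^ i • ω with hPdef
  have hPeq : ∀ (i : ℤ) b d, d ∈ gens a → (∀ j, i ≤ j → j < i + (S - s : ℕ) → bit a S j d = b j) →
      d • τ ^ i • ω = P i b := by
    intro i b d hd hb
    refine (hP.smul_eq_smul_iff hF hsS hr hd (hD i b) i i).2 ⟨0, by simp, fun j h1 h2 => ?_⟩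
    rw [hb j h1 h2, mul_zero, add_zero, hbits i b j h1 (by omega)]
    simp
  have hPker : ∀ i b i' b', P i b = P i' b' ↔ ∃ t : ℤ, i' = i + r * t ∧ ∀ j, i ≤ j →
      j < i + (S - s : ℕ) → b' (j + r * t) = b j + t * bit a S 0 (τ ^ (r : ℤ)) := by
    intro i b i' b'
    rw [hPdef, hP.smul_eq_smul_iff hF hsS hr (hD i b) (hD i' b')]
    refine exists_congr fun t => and_congr_right fun ht => forall_congr' fun j =>
      forall_congr' fun h1 => forall_congr' fun h2 => ?_
    rw [hbits i b j h1 (by omega), hbits i' b' _ (by omega) (by omega)]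
  have hPsucc : ∀ i b, N (P i b) (P (i + 1) b) := by
    intro i b
    rw [← hPeq (i + 1) b (D i b) (hD i b) fun j h1 h2 => hbits i b j (by omega) (by omega)]
    exact h.smul_N _ _ _ (h.arc_zpow hP.adj i)
  have hPout : ∀ i b y, N (P i b) y → ∃ b', P i b = P i b' ∧ y = P (i + 1) b' := by
    intro i b y hy
    obtain ⟨e, he, h1, h2⟩ := h.exists_out hP (hD i b) hy
    exact ⟨fun j => bit a S j e, h1.symm.trans (hPeq _ _ _ he fun _ _ _ => rfl),
      h2.symm.trans (hPeq _ _ _ he fun _ _ _ => rfl)⟩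
  have hPin : ∀ i b y, N y (P i b) → ∃ i' b', P i' b' = y := by
    intro i b y hy
    obtain ⟨e, he, h1⟩ := h.exists_in hP (hD i b) hy
    exact ⟨i - 1, fun j => bit a S j e, (hPeq _ _ _ he fun _ _ _ => rfl).symm.trans h1⟩
  have hPM : ∀ i b i' b', M (P i b) ≠ P i' b' := fun i b i' b' =>
    h.M_ne hP hF hs (hD i b) (hD i' b') i i'
  have hcode : ∀ x, (∃ i b, P i b = x) ∨ ∃ i b, P i b = M x := by
    intro x
    rcases h.exists_code hP x with ⟨i, d, hd, hx⟩ | ⟨i, d, hd, hx⟩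
    · exact .inl ⟨i, fun j => bit a S j d, (hPeq _ _ _ hd fun _ _ _ => rfl).symm.trans hx⟩
    · exact .inr ⟨i, fun j => bit a S j d, (hPeq _ _ _ hd fun _ _ _ => rfl).symm.trans hx⟩
  have hMinj : ∀ x y, M x = M y ↔ x = y := fun x y =>
    ⟨fun e => by rw [← h.invol x, e, h.invol], congrArg M⟩
  clear_value P
  refine ⟨r, hP.le_card_of_period hr, S - s, hP.sub_le_card hF hsS, bit a S 0 (τ ^ (r : ℤ)),
    fun u => cond u.2.2 (M (P u.1 u.2.1)) (P u.1 u.2.1), ?_, ?_, ?_⟩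
  · intro x
    rcases hcode x with ⟨i, b, hx⟩ | ⟨i, b, hx⟩
    · exact ⟨(i, b, false), hx⟩
    · exact ⟨(i, b, true), by simp [hx, h.invol]⟩
  · rintro ⟨i, b, _ | _⟩ ⟨i', b', _ | _⟩
    · simpa [codeRel] using hPker i b i' b'
    · simpa [codeRel] using (hPM i' b' i b).symm
    · simpa [codeRel] using hPM i b i' b'
    · simpa [codeRel, hMinj] using hPker i b i' b'
  · intro x y
    constructor
    · intro hxy
      have key : ∀ x y, N (M x) y → ∀ i b, P i b = M x → ∃ u v : Code,
          cond u.2.2 (M (P u.1 u.2.1)) (P u.1 u.2.1) = x ∧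
          cond v.2.2 (M (P v.1 v.2.1)) (P v.1 v.2.1) = y ∧ (codeEdge u v ∨ codeEdge v u) := by
        intro x y hxy i b hx
        rw [← hx] at hxy
        obtain ⟨b', h1, h2⟩ := hPout i b y hxy
        refine ⟨(i, b', true), (i + 1, b', false), ?_, h2.symm, .inl (.inr ⟨rfl, rfl, rfl, rfl⟩)⟩
        rw [cond_true, ← h1, hx, h.invol]
      rcases (hΓ x y).1 hxy with rfl | hN
      · rcases hcode x with ⟨i, b, hx⟩ | ⟨i, b, hx⟩
        · exact ⟨(i, b, false), (i, b, true), hx, by simp [hx], .inl (.inl ⟨rfl, rfl, rfl, rfl⟩)⟩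
        · exact ⟨(i, b, true), (i, b, false), by simp [hx, h.invol], hx,
            .inr (.inl ⟨rfl, rfl, rfl, rfl⟩)⟩
      · rcases hcode (M x) with ⟨i, b, hx⟩ | ⟨i, b, hx⟩
        · exact key x y hN i b hx
        · have hN' := h.rev _ _ hN
          rw [h.invol] at hN'
          rcases hcode (M y) with ⟨i', b', hy⟩ | ⟨i', b', hy⟩
          · obtain ⟨u, v, hu, hv, huv⟩ := key y x hN' i' b' hy
            exact ⟨v, u, hv, hu, huv.symm⟩
          · rw [h.invol] at hx hy
            rw [← hy] at hN
            obtain ⟨i'', b'', h1⟩ := hPin _ _ _ hN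
            exact absurd (by rw [hx, h1]) (hPM i b i'' b'')
    · have key : ∀ u v : Code, codeEdge u v → Γ.Adj (cond u.2.2 (M (P u.1 u.2.1)) (P u.1 u.2.1))
          (cond v.2.2 (M (P v.1 v.2.1)) (P v.1 v.2.1)) := by
        rintro ⟨i, b, u⟩ ⟨i', b', v⟩ (⟨h1, h2, h3, h4⟩ | ⟨h1, h2, h3, h4⟩)
        · simp only at h1 h2 h3 h4
          subst h1 h2 h3 h4
          exact (hΓ _ _).2 (.inl rfl)
        · simp only at h1 h2 h3 h4
          subst h1 h2 h3 h4
          refine (hΓ _ _).2 (.inr ?_)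
          simpa [h.invol] using hPsucc i b
      rintro ⟨u, v, rfl, rfl, huv | huv⟩
      · exact key u v huv
      · exact (key v u huv).symm

end TransDigraph

end Coding

section Counting

theorem CubicTransitive.exists_isCoding {V : Type*} [Finite V] {Γ : SimpleGraph V}
    (h : CubicTransitive Γ) {n : ℕ} (hn : 768 ≤ n) (hV : Nat.card V ≤ n)
    (hA : n ^ 2 < Nat.card (Γ ≃g Γ)) :
    ∃ r ≤ n, ∃ p ≤ n, ∃ ε π, IsCoding Γ r p ε π := by
  rcases h.card_le_or_exists_transDigraph with h1 | ⟨M, N, hD, hΓ⟩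
  · exact absurd hA (by nlinarith)
  obtain ⟨ω⟩ := h.conn.nonempty
  obtain ⟨τ, a, s, hP⟩ := hD.exists_pathGenerators ω
  have e : MulAction.stabilizer (Γ ≃g Γ) ω = window a (0 - s + 1) 0 := by
    ext g
    have := hP.stab 0 g
    rwa [zpow_zero, one_smul] at this
  have h2 : Nat.card (window a (0 - s + 1) 0) = 2 ^ s := by
    have := hP.reg.card_window hP.sys (0 - s + 1) s le_rfl
    rwa [show (0 - s + 1 + s - 1 : ℤ) = 0 by ring] at this
  have hG := h.card_stabilizer_eq ω
  rw [e, h2] at hG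
  have hns : n < 2 ^ s := by
    by_contra hcon
    have := Nat.mul_le_mul hV (not_lt.1 hcon)
    nlinarith
  have hs : 2 ≤ s := by
    by_contra hcon
    have : 2 ^ s ≤ 2 ^ 1 := Nat.pow_le_pow_right (by norm_num) (by omega)
    omega
  have hG' : Nat.card (Γ ≃g Γ) < 2 ^ (2 * s) := by
    rw [hG, two_mul, pow_add]
    exact Nat.mul_lt_mul_of_pos_right (hV.trans_lt hns) (by positivity)
  obtain ⟨S, hsS, hF⟩ := hP.reg.exists_fullWindows hP.sys hG' (by omega)
  obtain ⟨r, hr, p, hp, hc⟩ :=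
    hD.exists_isCoding hP hF hΓ hs (hP.lt_of_fullWindows hF hsS)
  exact ⟨r, hr.trans hV, p, hp.trans hV, hc⟩

theorem cubicTransitive_of_dValent {V : Type*} {Γ : SimpleGraph V} (hc : Γ.Connected)
    (hd : DValent Γ 3) (ht : IsVertexTransitive Γ) : CubicTransitive Γ where
  conn := hc
  three v := by
    obtain ⟨x, y, z, h1, h2, h3, h4⟩ := Set.ncard_eq_three.1 (hd v)
    exact ⟨x, y, z, h1, h2, h3, fun w => by rw [← mem_neighborSet, h4]; simp⟩
  trans := ht

theorem bigAutCount_le {n : ℕ} (hn : 768 ≤ n) : bigAutCount n ≤ (n + 1) * (n + 1) * 2 := by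
  have key : ∀ q : Quotient (graphSetoid (fun x => x.1 ≤ n ∧ x.2.Connected ∧ DValent x.2 3 ∧
      IsVertexTransitive x.2 ∧ n ^ 2 < Nat.card (x.2 ≃g x.2))),
      ∃ c : Fin (n + 1) × Fin (n + 1) × ZMod 2, ∃ π, IsCoding q.out.1.2 c.1 c.2.1 c.2.2 π := by
    intro q
    obtain ⟨h1, h2, h3, h4, h5⟩ := q.out.2
    obtain ⟨r, hr, p, hp, ε, hc⟩ := (cubicTransitive_of_dValent h2 h3 h4).exists_isCoding hn
      (by simpa using h1) h5
    exact ⟨(⟨r, by omega⟩, ⟨p, by omega⟩, ε), hc⟩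
  choose c hc using key
  have hinj : Function.Injective c := by
    intro q q' hqq
    obtain ⟨π, hπ⟩ := hc q
    obtain ⟨ρ, hρ⟩ := hc q'
    rw [← hqq] at hρ
    exact Quotient.out_equiv_out.1 (hπ.nonempty_iso hρ)
  have := Nat.card_le_card_of_injective c hinj
  simp only [Nat.card_prod, Nat.card_fin, Nat.card_zmod] at this
  rw [bigAutCount, numIsoClasses]
  linarith

end Counting

/-- There exists a positive constant `c` such that for every `n ≥ 1`, the number of
isomorphism classes of connected 3-valent vertex-transitive graphs `Γ` with at most `n`
vertices and `|Aut(Γ)| > n²` is at most `c·n²`. -/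
theorem big_aut_count_upper_bound :
    ∃ c : ℝ, 0 < c ∧ ∀ n : ℕ, 1 ≤ n →
      (bigAutCount n : ℝ) ≤ c * (n : ℝ) ^ 2 := by
  have hS : 0 ≤ ∑ k ∈ Finset.range 768, (bigAutCount k : ℝ) :=
    Finset.sum_nonneg fun _ _ => Nat.cast_nonneg _
  have hle : ∀ n < 768, (bigAutCount n : ℝ) ≤ ∑ k ∈ Finset.range 768, (bigAutCount k : ℝ) :=
    fun n hn => Finset.single_le_sum (f := fun k => (bigAutCount k : ℝ))
      (fun _ _ => Nat.cast_nonneg _) (Finset.mem_range.2 hn)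
  generalize ∑ k ∈ Finset.range 768, (bigAutCount k : ℝ) = B at hS hle
  refine ⟨8 + B, by positivity, fun n hn => ?_⟩
  have hn1 : (1 : ℝ) ≤ n := by exact_mod_cast hn
  rcases lt_or_ge n 768 with hlt | hge
  · have h1 : (1 : ℝ) ≤ (n : ℝ) ^ 2 := one_le_pow₀ hn1
    have := hle n hlt
    nlinarith [mul_le_mul_of_nonneg_left h1 hS]
  · have : (bigAutCount n : ℝ) ≤ (n + 1) * (n + 1) * 2 := by exact_mod_cast bigAutCount_le hge
    nlinarith
end

section
/- Let Γ be a finite connected d-valent graph and let G be a group of automorphisms of Γ acting transitively on the vertices of Γ. Then there exists a subgroup H of G generated by at most d elements such that H acts transitively on the vertices of Γ. -/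
open SimpleGraph

/-- If the subgroup `H` moves `v` to each of its neighbours, then the `H`-orbit of `v` contains
every vertex reachable from `v`. -/
theorem exists_mem_apply_eq_of_reachable {V : Type*} {Γ : SimpleGraph V}
    {H : Subgroup (Γ ≃g Γ)} {v : V} (hH : ∀ w, Γ.Adj v w → ∃ h ∈ H, h v = w) {u : V}
    (hu : Γ.Reachable v u) : ∃ h ∈ H, h v = u := by
  rw [SimpleGraph.reachable_iff_reflTransGen] at hu
  induction hu with
  | refl => exact ⟨1, H.one_mem, rfl⟩
  | @tail a b _ hab ih =>
    obtain ⟨h, hh, rfl⟩ := ih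
    have hadj : Γ.Adj v (h.symm b) := by
      rw [← h.map_adj_iff]
      simpa using hab
    obtain ⟨k, hk, hkv⟩ := hH _ hadj
    refine ⟨h * k, H.mul_mem hh hk, ?_⟩
    rw [RelIso.mul_apply, hkv]
    exact h.apply_symm_apply b

/-- If `Γ` is a finite connected `d`-valent graph and `G` is a group of automorphisms of `Γ`
acting transitively on the vertices, then some subgroup `H ≤ G` generated by at most `d`
elements still acts transitively on the vertices. -/
theorem exists_d_generated_transitive_subgroup
    {V : Type*} [Fintype V] (Γ : SimpleGraph V) (d : ℕ)
    (hconn : Γ.Connected) (hval : DValent Γ d)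
    (G : Subgroup (Γ ≃g Γ)) (htrans : ∀ u v : V, ∃ g ∈ G, g u = v) :
    ∃ H : Subgroup (Γ ≃g Γ), H ≤ G ∧
      (∃ s : Finset (Γ ≃g Γ), s.card ≤ d ∧ Subgroup.closure (s : Set (Γ ≃g Γ)) = H) ∧
      ∀ u v : V, ∃ h ∈ H, h u = v := by
  classical
  obtain ⟨v⟩ := hconn.nonempty
  choose g hgG hgv using htrans v
  let s : Finset (Γ ≃g Γ) := (Γ.neighborSet v).toFinset.image g
  have hH : ∀ u, ∃ h ∈ Subgroup.closure (s : Set (Γ ≃g Γ)), h v = u := fun u ↦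
    exists_mem_apply_eq_of_reachable
      (fun w hw ↦ ⟨g w, Subgroup.subset_closure (by
        simpa [s] using ⟨w, hw, rfl⟩), hgv w⟩) (hconn.preconnected v u)
  refine ⟨Subgroup.closure s, ?_, ⟨s, ?_, rfl⟩, fun u w ↦ ?_⟩
  · rw [Subgroup.closure_le]
    intro x hx
    obtain ⟨w, -, rfl⟩ := Finset.mem_image.mp (Finset.mem_coe.mp hx)
    exact hgG w
  · rw [← hval v, Set.ncard_eq_toFinset_card']
    exact Finset.card_image_le
  · obtain ⟨h, hh, rfl⟩ := hH u
    obtain ⟨k, hk, rfl⟩ := hH w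
    refine ⟨k * h⁻¹, mul_mem hk (inv_mem hh), ?_⟩
    rw [RelIso.mul_apply, RelIso.inv_apply_self]
end
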